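/- arXiv:1806.02838 — 2 statements merged into one kernel-verified Lean document; each statement's English description precedes it below -/
import Mathlib

section
/- There exists a positive integer p_0 such that for all integers p ≥ p_0 there exist constants c_1, c_2 > 0 with c_1 · n^{7/5} ≤ ex(n, S_p) ≤ c_2 · n^{7/5} for all sufficiently large n; that is, ex(n, S_p) = Θ(n^{7/5}). -/
open SimpleGraph Filter

/-- `G` contains a copy of `H` (an injective graph homomorphism from `H` to `G`). -/
def SimpleGraph.Contains {α β : Type*} (G : SimpleGraph α) (H : SimpleGraph β) : Prop :=
  ∃ f : H →g G, Function.Injective f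

/-- The Turán number `ex(n, H)`: the maximum number of edges in an `n`-vertex
graph containing no copy of `H`. -/
noncomputable def exNum {β : Type*} (n : ℕ) (H : SimpleGraph β) : ℕ :=
  sSup {N : ℕ | ∃ G : SimpleGraph (Fin n), ¬ G.Contains H ∧ G.edgeSet.ncard = N}

/-- The 3-comb-pasting `S_p`: `p` disjoint copies of the 3-comb `T₃` (a path `a b c` plus
pendant vertices attached to `a`, `b`, `c`), with the `p` images of the pendant vertex at `a`
identified into the single vertex `Sum.inl 0`, those at `b` into `Sum.inl 1`, and those at `c`
into `Sum.inl 2`; the `i`-th copy of the path is `(i,0) (i,1) (i,2)`. -/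
def combPasting (p : ℕ) : SimpleGraph (Fin 3 ⊕ (Fin p × Fin 3)) :=
  SimpleGraph.fromRel fun x y =>
    match x, y with
    | Sum.inl j, Sum.inr (_, jj) => j = jj
    | Sum.inr (i, j), Sum.inr (ii, jj) => i = ii ∧ (jj : ℕ) = (j : ℕ) + 1
    | _, _ => False
namespace SimpleGraph

open Finset

/-- A copy of `S_p` assembled from its three roots and its `p` paths. -/
theorem contains_combPasting_of_paths {V : Type*} {G : SimpleGraph V} {p : ℕ} (r : Fin 3 → V)
    (x : Fin p × Fin 3 → V) (hr : Function.Injective r) (hx : Function.Injective x)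
    (hrx : ∀ j k, r j ≠ x k) (hroot : ∀ i j, G.Adj (r j) (x (i, j)))
    (hpath : ∀ i, G.Adj (x (i, 0)) (x (i, 1)) ∧ G.Adj (x (i, 1)) (x (i, 2))) :
    G.Contains (combPasting p) := by
  have key : ∀ i (j k : Fin 3), (k : ℕ) = j + 1 → G.Adj (x (i, j)) (x (i, k)) := by
    intro i j k h
    fin_cases j <;> fin_cases k <;> simp at h
    · exact (hpath i).1
    · exact (hpath i).2
  refine ⟨⟨Sum.elim r x, ?_⟩, hr.sumElim hx hrx⟩
  rintro (j | ⟨i, j⟩) (k | ⟨i', k⟩) h <;>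
    simp only [combPasting, fromRel_adj, Sum.elim_inl, Sum.elim_inr, or_false, false_or,
      and_false] at h ⊢
  · obtain ⟨-, rfl⟩ := h
    exact hroot _ _
  · obtain ⟨-, rfl⟩ := h
    exact (hroot _ _).symm
  · obtain ⟨-, ⟨rfl, h⟩ | ⟨rfl, h⟩⟩ := h
    · exact key _ _ _ h
    · exact (key _ _ _ h).symm

/-- A copy of `S_p` assembled from combs which share their pendant vertices `u`, `v`, `w` and are
otherwise disjoint. -/
theorem contains_combPasting_of_disjoint {V : Type*} [DecidableEq V] {G : SimpleGraph V} {p : ℕ}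
    {u v w : V} {a b c : Fin p → V} (hr : [u, v, w].Nodup)
    (hnd : ∀ i, [u, v, w, a i, b i, c i].Nodup)
    (hdisj : ∀ i j, i ≠ j → Disjoint ({a i, b i, c i} : Finset V) {a j, b j, c j})
    (hua : ∀ i, G.Adj u (a i)) (hvb : ∀ i, G.Adj v (b i)) (hwc : ∀ i, G.Adj w (c i))
    (hab : ∀ i, G.Adj (a i) (b i)) (hbc : ∀ i, G.Adj (b i) (c i)) :
    G.Contains (combPasting p) := by
  have hinj (i) : Function.Injective ![a i, b i, c i] := by
    rw [← List.nodup_ofFn]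
    simpa using (hnd i).sublist (List.suffix_append [u, v, w] _).sublist
  refine contains_combPasting_of_paths ![u, v, w] (fun k => ![a k.1, b k.1, c k.1] k.2) ?_ ?_ ?_
    ?_ fun i => ⟨hab i, hbc i⟩
  · rw [← List.nodup_ofFn]
    simpa using hr
  · rintro ⟨i, j⟩ ⟨i', j'⟩ h
    dsimp only at h
    have hmem : ∀ i (j : Fin 3), ![a i, b i, c i] j ∈ ({a i, b i, c i} : Finset V) := by
      intro i j
      fin_cases j <;> simp
    obtain rfl : i = i' := by
      by_contra hne
      exact Finset.disjoint_left.1 (hdisj i i' hne) (hmem i j) (h ▸ hmem i' j')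
    rw [hinj i h]
  · rintro j ⟨i, k⟩ h
    have hd : List.Disjoint [u, v, w] [a i, b i, c i] := List.disjoint_of_nodup_append (hnd i)
    have hj : ![u, v, w] j ∈ [u, v, w] := by fin_cases j <;> simp
    have hk : ![a i, b i, c i] k ∈ [a i, b i, c i] := by fin_cases k <;> simp
    exact hd hj (h ▸ hk)
  · intro i j
    fin_cases j
    · exact hua i
    · exact hvb i
    · exact hwc i

end SimpleGraph

open Finset in
/-- Greedy choice of pairwise non-conflicting elements. -/
theorem Finset.exists_subset_card_eq_pairwise_of_conflicts_le {α : Type*} [DecidableEq α]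
    (s : Finset α) (R : α → α → Prop) [DecidableRel R] (hR : ∀ x y, R x y → R y x) (B : ℕ)
    (hB : ∀ x ∈ s, #{y ∈ s | y = x ∨ R x y} ≤ B) (k : ℕ) (hk : k * B < #s + B) :
    ∃ t ⊆ s, #t = k ∧ (t : Set α).Pairwise fun x y => ¬ R x y := by
  induction k with
  | zero => exact ⟨∅, by simp, by simp, by simp⟩
  | succ k ih =>
    obtain ⟨t, hts, htk, ht⟩ := ih (by rw [add_mul] at hk; omega)
    have hcard : #(t.biUnion fun x => {y ∈ s | y = x ∨ R x y}) ≤ k * B := by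
      rw [← htk]
      exact card_biUnion_le_card_mul _ _ _ fun x hx => hB x (hts hx)
    obtain ⟨y, hys, hy⟩ := exists_mem_notMem_of_card_lt_card
      (lt_of_le_of_lt hcard (by rw [add_mul] at hk; omega) : _ < #s)
    simp only [mem_biUnion, mem_filter, not_exists, not_and, not_or] at hy
    have hyt : y ∉ t := fun h => (hy y h hys).1 rfl
    refine ⟨insert y t, insert_subset hys hts, by rw [card_insert_of_notMem hyt, htk], ?_⟩
    rw [coe_insert, Set.pairwise_insert]
    exact ⟨ht, fun x hx _ => ⟨fun h => (hy x hx hys).2 (hR _ _ h), (hy x hx hys).2⟩⟩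

open Finset in
/-- Distinct representatives avoiding a forbidden set, for a family of large sets. -/
theorem Finset.exists_injective_notMem_of_card_le {ι α : Type*} [Fintype ι] [DecidableEq α]
    (s : ι → Finset α) (F : Finset α) (h : ∀ i, Fintype.card ι + #F ≤ #(s i)) :
    ∃ f : ι → α, Function.Injective f ∧ ∀ i, f i ∈ s i ∧ f i ∉ F := by
  obtain ⟨f, hf, hfs⟩ := (Finset.all_card_le_biUnion_card_iff_exists_injective
    fun i => s i \ F).1 (by
      intro u
      rcases u.eq_empty_or_nonempty with rfl | ⟨i, hi⟩
      · simp
      · have h1 := card_le_card (subset_biUnion_of_mem (fun i => s i \ F) hi)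
        have h2 := le_card_sdiff F (s i)
        have h3 := card_le_univ u
        have h4 := h i
        omega)
  exact ⟨f, hf, fun i => by simpa using hfs i⟩

namespace SimpleGraph

open Finset

variable {V : Type*} [Fintype V] [DecidableEq V] (G : SimpleGraph V) [DecidableRel G.Adj]

/-- The common neighbours of two vertices, if there are fewer than `T` of them. -/
def lightCommon (T : ℕ) (u v : V) : Finset V :=
  if #(G.neighborFinset u ∩ G.neighborFinset v) < T then
    G.neighborFinset u ∩ G.neighborFinset v else ∅

theorem mem_lightCommon {T : ℕ} {u v w : V} : w ∈ G.lightCommon T u v ↔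
    #(G.neighborFinset u ∩ G.neighborFinset v) < T ∧ G.Adj u w ∧ G.Adj v w := by
  unfold lightCommon
  split_ifs with h <;> simp [h]

theorem card_lightCommon_le (T : ℕ) (u v : V) : #(G.lightCommon T u v) ≤ T := by
  unfold lightCommon
  split_ifs with h
  · exact h.le
  · simp

/-- The paths `x = (a, b, c)` which form a comb with pendant vertices `r = (a', b', c')`, such that
the pairs `ab'`, `cb'`, `ba'`, `bc'` have few common neighbours. -/
def lightCombs (T : ℕ) (r : V × V × V) : Finset (V × V × V) :=
  {x | [r.1, r.2.1, r.2.2, x.1, x.2.1, x.2.2].Nodup ∧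
    x.2.1 ∈ G.lightCommon T x.1 r.2.1 ∧ x.2.1 ∈ G.lightCommon T x.2.2 r.2.1 ∧
    x.1 ∈ G.lightCommon T x.2.1 r.1 ∧ x.2.2 ∈ G.lightCommon T x.2.1 r.2.2}

theorem card_lightCombs_left_le (T : ℕ) (r : V × V × V) (z : V) :
    #{y ∈ G.lightCombs T r | y.1 = z} ≤ T * T := by
  calc _ ≤ #((G.lightCommon T z r.2.1).biUnion fun b =>
        (G.lightCommon T b r.2.2).image fun c => (z, b, c)) := by
        refine card_le_card fun ⟨a, b, c⟩ h => ?_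
        simp only [lightCombs, mem_filter, mem_univ, true_and] at h
        obtain ⟨⟨-, h1, h2, h3, h4⟩, rfl⟩ := h
        simp only [mem_biUnion, mem_image]
        exact ⟨b, h1, c, h4, rfl⟩
    _ ≤ #(G.lightCommon T z r.2.1) * T := card_biUnion_le_card_mul _ _ _ fun b _ =>
        card_image_le.trans (G.card_lightCommon_le ..)
    _ ≤ T * T := Nat.mul_le_mul_right _ (G.card_lightCommon_le ..)

theorem card_lightCombs_middle_le (T : ℕ) (r : V × V × V) (z : V) :
    #{y ∈ G.lightCombs T r | y.2.1 = z} ≤ T * T := by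
  calc _ ≤ #((G.lightCommon T z r.1).biUnion fun a =>
        (G.lightCommon T z r.2.2).image fun c => (a, z, c)) := by
        refine card_le_card fun ⟨a, b, c⟩ h => ?_
        simp only [lightCombs, mem_filter, mem_univ, true_and] at h
        obtain ⟨⟨-, h1, h2, h3, h4⟩, rfl⟩ := h
        simp only [mem_biUnion, mem_image]
        exact ⟨a, h3, c, h4, rfl⟩
    _ ≤ #(G.lightCommon T z r.1) * T := card_biUnion_le_card_mul _ _ _ fun b _ =>
        card_image_le.trans (G.card_lightCommon_le ..)
    _ ≤ T * T := Nat.mul_le_mul_right _ (G.card_lightCommon_le ..)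

theorem card_lightCombs_right_le (T : ℕ) (r : V × V × V) (z : V) :
    #{y ∈ G.lightCombs T r | y.2.2 = z} ≤ T * T := by
  calc _ ≤ #((G.lightCommon T z r.2.1).biUnion fun b =>
        (G.lightCommon T b r.1).image fun a => (a, b, z)) := by
        refine card_le_card fun ⟨a, b, c⟩ h => ?_
        simp only [lightCombs, mem_filter, mem_univ, true_and] at h
        obtain ⟨⟨-, h1, h2, h3, h4⟩, rfl⟩ := h
        simp only [mem_biUnion, mem_image]
        exact ⟨b, h2, a, h3, rfl⟩
    _ ≤ #(G.lightCommon T z r.2.1) * T := card_biUnion_le_card_mul _ _ _ fun b _ =>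
        card_image_le.trans (G.card_lightCommon_le ..)
    _ ≤ T * T := Nat.mul_le_mul_right _ (G.card_lightCommon_le ..)

/-- Three fixed roots support boundedly many light combs in an `S_p`-free graph. -/
theorem card_lightCombs_le {p : ℕ} (hG : ¬ G.Contains (combPasting p)) (T : ℕ) (r : V × V × V) :
    #(G.lightCombs T r) ≤ p * (9 * T ^ 2) := by
  by_contra! hlt
  let W : V × V × V → Finset V := fun x => {x.1, x.2.1, x.2.2}
  obtain ⟨t, hts, htp, ht⟩ := exists_subset_card_eq_pairwise_of_conflicts_le (G.lightCombs T r)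
    (fun x y => ¬ Disjoint (W x) (W y)) (fun x y h => by rwa [disjoint_comm]) (9 * T ^ 2)
    (by
      intro x _
      calc _ ≤ #((W x).biUnion fun z => {y ∈ G.lightCombs T r | y.1 = z} ∪
            ({y ∈ G.lightCombs T r | y.2.1 = z} ∪ {y ∈ G.lightCombs T r | y.2.2 = z})) := by
            refine card_le_card fun y hy => ?_
            obtain ⟨hy, h⟩ := mem_filter.1 hy
            have h' : ∃ z ∈ W x, z ∈ W y := by
              rcases h with rfl | h
              · exact ⟨y.1, by simp [W], by simp [W]⟩
              · exact not_disjoint_iff.1 h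
            obtain ⟨z, hzx, hzy⟩ := h'
            refine mem_biUnion.2 ⟨z, hzx, ?_⟩
            simp only [mem_union, mem_filter, hy, true_and]
            simpa [W, eq_comm] using hzy
        _ ≤ #(W x) * (3 * T ^ 2) := by
            refine card_biUnion_le_card_mul _ _ _ fun z _ => ?_
            have h1 := G.card_lightCombs_left_le T r z
            have h2 := G.card_lightCombs_middle_le T r z
            have h3 := G.card_lightCombs_right_le T r z
            refine (card_union_le _ _).trans ?_
            have h4 := card_union_le {y ∈ G.lightCombs T r | y.2.1 = z}
              {y ∈ G.lightCombs T r | y.2.2 = z}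
            rw [pow_two]
            omega
        _ ≤ 3 * (3 * T ^ 2) := Nat.mul_le_mul_right _ card_le_three
        _ = _ := by ring) p (by omega)
  let e := (Finset.equivFinOfCardEq htp).symm
  have hnd : ∀ x ∈ G.lightCombs T r, [r.1, r.2.1, r.2.2, x.1, x.2.1, x.2.2].Nodup :=
    fun x hx => (mem_filter.1 hx).2.1
  have hmem : ∀ i, (e i : V × V × V) ∈ G.lightCombs T r := fun i => hts (e i).2
  have hadj := fun i => (mem_filter.1 (hmem i)).2.2
  simp only [mem_lightCommon] at hadj
  obtain ⟨y, hy⟩ : (G.lightCombs T r).Nonempty := card_pos.1 (by omega)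
  exact hG (contains_combPasting_of_disjoint ((hnd y hy).sublist (by simp))
    (fun i => hnd _ (hmem i))
    (fun i j hij => not_not.1 (ht (e i).2 (e j).2 fun h => hij (e.injective (Subtype.ext h))))
    (fun i => (hadj i).2.2.1.2.2) (fun i => (hadj i).1.2.2) (fun i => (hadj i).2.2.2.2.2)
    (fun i => (hadj i).1.2.1) (fun i => (hadj i).2.2.2.2.1))

/-- The neighbours of `v` having at least `T` common neighbours with `u`. -/
def heavyNeighbors (T : ℕ) (v u : V) : Finset V :=
  {w ∈ G.neighborFinset v | w ≠ u ∧ T ≤ #(G.neighborFinset u ∩ G.neighborFinset w)}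

theorem card_heavyNeighbors_inter_lt {p : ℕ} (hG : ¬ G.Contains (combPasting p)) {v x y : V}
    (hx : G.Adj v x) (hy : G.Adj v y) (hxy : x ≠ y) :
    #(G.heavyNeighbors (3 * p + 3) v x ∩ G.heavyNeighbors (3 * p + 3) v y) < p := by
  by_contra! hle
  obtain ⟨t, hts, htp⟩ := exists_subset_card_eq hle
  let e := (Finset.equivFinOfCardEq htp).symm
  let b : Fin p → V := fun i => e i
  have hbt : ∀ i, b i ∈ t := fun i => (e i).2
  have hb : ∀ i j, i ≠ j → b i ≠ b j := fun i j hij h => hij (e.injective (Subtype.ext h))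
  have hmem := fun i => hts (hbt i)
  simp only [heavyNeighbors, mem_inter, mem_filter, mem_neighborFinset] at hmem
  obtain ⟨f, hf, hfs⟩ := exists_injective_notMem_of_card_le
    (Sum.elim (fun i : Fin p => G.neighborFinset x ∩ G.neighborFinset (b i))
      (fun i : Fin p => G.neighborFinset y ∩ G.neighborFinset (b i))) ({v, x, y} ∪ t) (by
      have h1 := card_union_le {v, x, y} t
      have h2 : #({v, x, y} : Finset V) ≤ 3 := card_le_three
      rintro (i | i)
      · have := (hmem i).1.2.2
        simp only [Fintype.card_sum, Fintype.card_fin, Sum.elim_inl]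
        omega
      · have := (hmem i).2.2.2
        simp only [Fintype.card_sum, Fintype.card_fin, Sum.elim_inr]
        omega)
  have ha := fun i => hfs (Sum.inl i)
  have hc := fun i => hfs (Sum.inr i)
  simp only [Sum.elim_inl, Sum.elim_inr, mem_inter, mem_neighborFinset, mem_union, mem_insert,
    mem_singleton, not_or] at ha hc
  have hxv := hx.ne
  have hyv := hy.ne
  refine hG (contains_combPasting_of_disjoint (u := x) (v := v) (w := y)
    (a := fun i => f (Sum.inl i)) (b := b) (c := fun i => f (Sum.inr i)) ?_ ?_ ?_
    (fun i => (ha i).1.1) (fun i => (hmem i).1.1) (fun i => (hc i).1.1)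
    (fun i => (ha i).1.2.symm) (fun i => (hc i).1.2))
  · simp [hxy, hxv.symm, hyv]
  · intro i
    have hac : f (Sum.inl i) ≠ f (Sum.inr i) := fun h => by simpa using hf h
    have h1 := ha i
    have h2 := hc i
    have h3 := hmem i
    have h4 := h3.1.1.ne
    have h5 := h1.1.2.ne
    have h6 := h2.1.2.ne
    simp only [List.nodup_cons, List.mem_cons, List.not_mem_nil, not_or, not_false_eq_true,
      List.nodup_nil, and_true]
    grind
  · intro i j hij
    have hij' := hb i j hij
    have h1 : f (Sum.inl i) ≠ f (Sum.inl j) := fun h => hij (by simpa using hf h)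
    have h2 : f (Sum.inr i) ≠ f (Sum.inr j) := fun h => hij (by simpa using hf h)
    have h3 : f (Sum.inl i) ≠ f (Sum.inr j) := fun h => by simpa using hf h
    have h4 : f (Sum.inr i) ≠ f (Sum.inl j) := fun h => by simpa using hf h
    have h5 : ∀ k l, f (Sum.inl k) ≠ b l := fun k l h => (ha k).2.2 (h ▸ hbt l)
    have h6 : ∀ k l, f (Sum.inr k) ≠ b l := fun k l h => (hc k).2.2 (h ▸ hbt l)
    simp only [Finset.disjoint_left, mem_insert, mem_singleton, not_or]
    rintro z (rfl | rfl | rfl)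
    · exact ⟨h1, h5 i j, h3⟩
    · exact ⟨(h5 j i).symm, hij', (h6 j i).symm⟩
    · exact ⟨h4, h6 i j, h2⟩

/-- The neighbours of `v` which have many common neighbours with at least half of the
neighbours of `v`. -/
def badNeighbors (T : ℕ) (v : V) : Finset V :=
  {u ∈ G.neighborFinset v | G.degree v ≤ 2 * #(G.heavyNeighbors T v u)}

theorem card_badNeighbors_le_two {p : ℕ} (hG : ¬ G.Contains (combPasting p)) {v : V}
    (hv : 6 * p < G.degree v) : #(G.badNeighbors (3 * p + 3) v) ≤ 2 := by
  by_contra! h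
  obtain ⟨x, hx, y, hy, z, hz, hxy, hxz, hyz⟩ := two_lt_card.1 h
  simp only [badNeighbors, mem_filter, mem_neighborFinset] at hx hy hz
  have h1 := G.card_heavyNeighbors_inter_lt hG hx.1 hy.1 hxy
  have h2 := G.card_heavyNeighbors_inter_lt hG hx.1 hz.1 hxz
  have h3 := G.card_heavyNeighbors_inter_lt hG hy.1 hz.1 hyz
  have hsub : ∀ u, G.heavyNeighbors (3 * p + 3) v u ⊆ G.neighborFinset v := fun u =>
    filter_subset _ _
  have h4 := card_union_add_card_inter (G.heavyNeighbors (3 * p + 3) v x)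
    (G.heavyNeighbors (3 * p + 3) v y)
  have h5 := card_union_add_card_inter (G.heavyNeighbors (3 * p + 3) v x ∪
    G.heavyNeighbors (3 * p + 3) v y) (G.heavyNeighbors (3 * p + 3) v z)
  rw [union_inter_distrib_right] at h5
  have h6 := card_union_le
    (G.heavyNeighbors (3 * p + 3) v x ∩ G.heavyNeighbors (3 * p + 3) v z)
    (G.heavyNeighbors (3 * p + 3) v y ∩ G.heavyNeighbors (3 * p + 3) v z)
  have h7 := card_le_card (union_subset (union_subset (hsub x) (hsub y)) (hsub z))
  rw [card_neighborFinset_eq_degree] at h7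
  omega

/-- The ordered adjacent pairs of vertices of degree at least `D`, neither of which is a bad
neighbour of the other. -/
def goodPairs (T D : ℕ) : Finset (V × V) :=
  {q | G.Adj q.1 q.2 ∧ D ≤ G.degree q.1 ∧ D ≤ G.degree q.2 ∧
    q.2 ∉ G.badNeighbors T q.1 ∧ q.1 ∉ G.badNeighbors T q.2}

theorem card_filter_adj : #{q : V × V | G.Adj q.1 q.2} = 2 * #G.edgeFinset := by
  rw [← G.sum_degrees_eq_twice_card_edges,
    card_eq_sum_card_fiberwise (f := Prod.fst) (t := univ) (by simp)]
  refine sum_congr rfl fun v _ => ?_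
  rw [← card_neighborFinset_eq_degree]
  refine card_nbij' Prod.snd (Prod.mk v) ?_ ?_ ?_ ?_ <;> intro x <;> aesop

theorem card_le_mul_card_of_snd_mem (s : Finset (V × V)) (t : V → Finset V)
    (k : ℕ) (hs : ∀ q ∈ s, q.2 ∈ t q.1) (ht : ∀ v, #(t v) ≤ k) : #s ≤ k * Fintype.card V := by
  refine card_le_mul_card_image_of_maps_to (f := Prod.fst) (t := univ) (by simp) k fun v _ => ?_
  refine (card_le_card_of_injOn Prod.snd ?_ ?_).trans (ht v)
  · intro q hq
    simp only [coe_filter, Set.mem_ofPred_eq] at hq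
    exact hq.2 ▸ hs q hq.1
  · rintro ⟨a, b⟩ h ⟨c, d⟩ h' hbd
    simp only [coe_filter, Set.mem_ofPred_eq] at h h'
    exact Prod.ext (h.2.trans h'.2.symm) hbd

theorem card_adj_le_card_goodPairs_add {p : ℕ} (hG : ¬ G.Contains (combPasting p)) {D : ℕ}
    (hD : 6 * p < D) :
    #{q : V × V | G.Adj q.1 q.2} ≤
      #(G.goodPairs (3 * p + 3) D) + 2 * ((D + 2) * Fintype.card V) := by
  let t : V → Finset V := fun v =>
    if G.degree v < D then G.neighborFinset v else G.badNeighbors (3 * p + 3) v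
  let s : Finset (V × V) := {q | q.2 ∈ t q.1}
  have ht : ∀ v, #(t v) ≤ D + 2 := by
    intro v
    simp only [t]
    split_ifs with h
    · rw [card_neighborFinset_eq_degree]
      omega
    · have := G.card_badNeighbors_le_two hG (v := v) (by omega)
      omega
  have hs : #s ≤ (D + 2) * Fintype.card V :=
    card_le_mul_card_of_snd_mem s t _ (by simp [s]) ht
  have hsub : ({q : V × V | G.Adj q.1 q.2} : Finset (V × V)) ⊆
      G.goodPairs (3 * p + 3) D ∪ (s ∪ s.image Prod.swap) := by
    rintro ⟨b, a⟩ h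
    simp only [mem_filter, mem_univ, true_and] at h
    simp only [mem_union, mem_image, goodPairs, mem_filter, mem_univ, true_and, s, Prod.exists,
      Prod.swap_prod_mk, Prod.mk.injEq]
    by_cases h1 : a ∈ t b
    · exact Or.inr (Or.inl h1)
    by_cases h2 : b ∈ t a
    · exact Or.inr (Or.inr ⟨a, b, h2, rfl, rfl⟩)
    refine Or.inl ⟨h, ?_⟩
    simp only [t] at h1 h2
    split_ifs at h1 h2 with h3 h4 h4 <;> simp_all [h.symm]
  have h1 := card_le_card hsub
  have h2 := card_union_le (G.goodPairs (3 * p + 3) D) (s ∪ s.image Prod.swap)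
  have h3 := card_union_le s (s.image Prod.swap)
  have h4 : #(s.image Prod.swap) ≤ #s := card_image_le
  omega

theorem lt_card_filter_not_heavy {T m : ℕ} {v u : V} (hvu : G.Adj v u)
    (hd : 2 * m + 2 ≤ G.degree v) (hu : u ∉ G.badNeighbors T v) :
    m < #{w ∈ G.neighborFinset v | w ≠ u ∧
      #(G.neighborFinset u ∩ G.neighborFinset w) < T} := by
  simp only [badNeighbors, mem_filter, mem_neighborFinset, hvu, true_and, not_le] at hu
  have h1 : G.neighborFinset v ⊆ insert u (G.heavyNeighbors T v u ∪
      {w ∈ G.neighborFinset v | w ≠ u ∧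
        #(G.neighborFinset u ∩ G.neighborFinset w) < T}) := by
    intro w hw
    simp only [heavyNeighbors, mem_insert, mem_union, mem_filter, hw, true_and]
    by_cases hwu : w = u
    · exact Or.inl hwu
    · simpa [hwu] using le_or_gt _ _
  have h2 := (card_le_card h1).trans (card_insert_le _ _)
  have h3 := card_union_le (G.heavyNeighbors T v u) {w ∈ G.neighborFinset v | w ≠ u ∧
        #(G.neighborFinset u ∩ G.neighborFinset w) < T}
  rw [card_neighborFinset_eq_degree] at h2
  omega

/-- For `q = (b, b')`, the good pairs `(b, a)` with `a ≠ b'` such that `a` and `b'` have few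
common neighbours. -/
def lightSpread (T D : ℕ) (q : V × V) : Finset (V × V) :=
  {g ∈ G.goodPairs T D | g.1 = q.1 ∧ q.2 ≠ g.2 ∧
    #(G.neighborFinset g.2 ∩ G.neighborFinset q.2) < T}

theorem mul_card_goodPairs_le_sum (T m : ℕ) :
    m * #(G.goodPairs T (2 * m + 2)) ≤
      ∑ q : V × V with G.Adj q.1 q.2, #(G.lightSpread T (2 * m + 2) q) := by
  have hdc := sum_card_bipartiteAbove_eq_sum_card_bipartiteBelow
    (s := ({q : V × V | G.Adj q.1 q.2} : Finset (V × V))) (t := G.goodPairs T (2 * m + 2))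
    (fun q g => g.1 = q.1 ∧ q.2 ≠ g.2 ∧ #(G.neighborFinset g.2 ∩ G.neighborFinset q.2) < T)
  calc _ ≤ _ := ?_
    _ = _ := hdc.symm
  rw [mul_comm, ← smul_eq_mul]
  refine card_nsmul_le_sum _ _ _ fun g hg => ?_
  simp only [goodPairs, mem_filter, mem_univ, true_and] at hg
  refine (G.lt_card_filter_not_heavy hg.1 hg.2.1 hg.2.2.2.1).le.trans ?_
  refine card_le_card_of_injOn (Prod.mk g.1) ?_ (by simp [Set.InjOn])
  intro w hw
  simpa [bipartiteBelow] using hw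

/-- The combs with centre `b` and pendant vertex `b'` at `b`, for a prescribed path `a b c`. -/
theorem sq_le_card_combs_of_mem_lightSpread {T m : ℕ} {b b' a c : V} (hbb : G.Adj b b')
    (ha : (b, a) ∈ G.lightSpread T (2 * m + 2) (b, b'))
    (hc : (b, c) ∈ G.lightSpread T (2 * m + 2) (b, b')) (hac : a ≠ c) :
    (m - 2) ^ 2 ≤ #{r : V × V × V | r.2.1 = b' ∧ (a, b, c) ∈ G.lightCombs T r} := by
  simp only [lightSpread, goodPairs, mem_filter, mem_univ, true_and] at ha hc
  obtain ⟨⟨hba, -, hda, -, hbada⟩, hb'a, hla⟩ := ha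
  obtain ⟨⟨hbc, -, hdc, -, hbadc⟩, hb'c, hlc⟩ := hc
  have hLa := G.lt_card_filter_not_heavy hba.symm hda hbada
  have hLc := G.lt_card_filter_not_heavy hbc.symm hdc hbadc
  set La : Finset V := {w ∈ G.neighborFinset a | w ≠ b ∧
      #(G.neighborFinset b ∩ G.neighborFinset w) < T} with hLa'
  set Lc : Finset V := {w ∈ G.neighborFinset c | w ≠ b ∧
      #(G.neighborFinset b ∩ G.neighborFinset w) < T} with hLc'
  have hcard : (m - 2) ^ 2 ≤
      #((La \ {c, b'}).sigma fun a' => Lc \ {a, b', a'}) := by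
    rw [card_sigma, pow_two]
    have h1 : m - 2 ≤ #(La \ {c, b'}) := by
      have := le_card_sdiff {c, b'} La
      have : #({c, b'} : Finset V) ≤ 2 := card_le_two
      omega
    refine (Nat.mul_le_mul_right _ h1).trans ?_
    rw [← smul_eq_mul]
    refine card_nsmul_le_sum _ _ _ fun a' _ => ?_
    have := le_card_sdiff {a, b', a'} Lc
    have : #({a, b', a'} : Finset V) ≤ 3 := card_le_three
    omega
  refine hcard.trans (card_le_card_of_injOn (fun z => (z.1, b', z.2)) ?_ ?_)
  · rintro ⟨a', c'⟩ h
    replace h := mem_sigma.1 (mem_coe.1 h)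
    simp only [Finset.mem_sdiff, mem_insert, mem_singleton, not_or, hLa', hLc', mem_filter,
      mem_neighborFinset] at h
    obtain ⟨⟨⟨haa, hab, hlab⟩, hca, hba'⟩, ⟨hcc, hcb, hlcb⟩, hca', hcb', hcc'⟩ := h
    simp only [coe_filter, Set.mem_ofPred_eq, mem_univ, true_and, lightCombs, mem_filter,
      mem_lightCommon, List.nodup_cons, List.mem_cons, List.not_mem_nil, not_or,
      not_false_eq_true, List.nodup_nil, and_true]
    have n1 := haa.ne
    have n2 := hcc.ne
    have n3 := hba.ne
    have n4 := hbc.ne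
    have n5 := hbb.ne
    exact ⟨by grind, ⟨hla, hba.symm, hbb.symm⟩, ⟨hlc, hbc.symm, hbb.symm⟩,
      ⟨hlab, hba, haa.symm⟩, hlcb, hbc, hcc.symm⟩
  · rintro ⟨a', c'⟩ - ⟨a'', c''⟩ - h
    simp only [Prod.mk.injEq, true_and] at h
    obtain ⟨rfl, rfl⟩ := h
    rfl

theorem sum_offDiag_le_sum_card_lightCombs (T m : ℕ) :
    (m - 2) ^ 2 * ∑ q : V × V with G.Adj q.1 q.2, #(G.lightSpread T (2 * m + 2) q).offDiag ≤
      ∑ r, #(G.lightCombs T r) := by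
  let Λ := ({q : V × V | G.Adj q.1 q.2} : Finset (V × V)).sigma
    fun q => (G.lightSpread T (2 * m + 2) q).offDiag
  let Ω := (univ : Finset (V × V × V)).sigma fun r => G.lightCombs T r
  let φ : (Σ _ : V × V × V, V × V × V) → Σ _ : V × V, (V × V) × (V × V) := fun z =>
    ⟨(z.2.2.1, z.1.2.1), (z.2.2.1, z.2.1), (z.2.2.1, z.2.2.2)⟩
  rw [← card_sigma, ← card_sigma]
  change _ * #Λ ≤ #Ω
  calc _ ≤ #{z ∈ Ω | φ z ∈ Λ} := ?_
    _ ≤ _ := card_filter_le _ _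
  refine mul_card_image_le_card_of_maps_to (f := φ) (fun z hz => (mem_filter.1 hz).2) _ ?_
  rintro ⟨⟨b, b'⟩, ⟨b₁, a⟩, ⟨b₂, c⟩⟩ h
  have h' := h
  simp only [Λ, mem_sigma, mem_filter, mem_univ, true_and, mem_offDiag] at h
  obtain ⟨hbb, ha, hc, hac⟩ := h
  obtain rfl : b₁ = b := (mem_filter.1 ha).2.1
  obtain rfl : b₂ = b₁ := (mem_filter.1 hc).2.1
  refine (G.sq_le_card_combs_of_mem_lightSpread hbb ha hc (by simpa using hac)).trans ?_
  refine card_le_card_of_injOn (fun r => ⟨r, (a, b₂, c)⟩) ?_ ?_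
  · rintro ⟨a', b'', c'⟩ hr
    simp only [coe_filter, mem_univ, true_and, Set.mem_ofPred_eq] at hr
    obtain ⟨rfl, hr⟩ := hr
    simp only [coe_filter, mem_filter, Set.mem_ofPred_eq, φ, h', and_true, Ω, mem_sigma, mem_univ,
      true_and, hr]
  · intro r _ r' _ h
    simpa using h

/-- A quantitative upper bound for the number of edges of an `S_p`-free graph. -/
theorem card_edgeFinset_lt_of_not_contains_combPasting {p : ℕ}
    (hG : ¬ G.Contains (combPasting p)) {l : ℕ} (hl : 2 ≤ l) (hlp : 6 * p ≤ l)
    (hn : 0 < Fintype.card V)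
    (hln : p * (9 * (3 * p + 3) ^ 2) * Fintype.card V ^ 2 < l ^ 5) :
    #G.edgeFinset < 8 * Fintype.card V * (l + 1) := by
  by_contra! hle
  set n := Fintype.card V
  set Q := p * (9 * (3 * p + 3) ^ 2)
  have hA := G.card_filter_adj
  set A : Finset (V × V) := {q : V × V | G.Adj q.1 q.2}
  have hgood := G.card_adj_le_card_goodPairs_add hG (D := 2 * (2 * l) + 2) (by omega)
  have hsum := G.mul_card_goodPairs_le_sum (3 * p + 3) (2 * l)
  have hoff := G.sum_offDiag_le_sum_card_lightCombs (3 * p + 3) (2 * l)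
  have hup : ∑ r, #(G.lightCombs (3 * p + 3) r) ≤ n ^ 3 * Q := by
    refine (sum_le_card_nsmul _ _ Q fun r _ => G.card_lightCombs_le hG _ r).trans ?_
    simp only [card_univ, Fintype.card_prod, smul_eq_mul]
    exact le_of_eq (by ring)
  set S := G.lightSpread (3 * p + 3) (2 * (2 * l) + 2)
  have hconv : 2 * l * ∑ q ∈ A, #(S q) ≤
      ∑ q ∈ A, #(S q).offDiag + #A * l ^ 2 + ∑ q ∈ A, #(S q) := by
    rw [← smul_eq_mul #A, ← sum_const, mul_sum, ← sum_add_distrib, ← sum_add_distrib]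
    refine sum_le_sum fun q _ => ?_
    have hs : #(S q) ≤ #(S q) * #(S q) := Nat.le_mul_self _
    rw [offDiag_card]
    zify [hs]
    nlinarith [sq_nonneg ((#(S q) : ℤ) - l)]
  set s := ∑ q ∈ A, #(S q)
  set o := ∑ q ∈ A, #(S q).offDiag
  set g := #(G.goodPairs (3 * p + 3) (2 * (2 * l) + 2))
  have hgA : #A ≤ 2 * g := by
    change #A ≤ g + _ at hgood
    nlinarith
  have hs : l * #A ≤ s := by nlinarith
  have ho : #A * (l ^ 2 - l) ≤ o := by
    have : l ≤ l ^ 2 := Nat.le_self_pow two_ne_zero l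
    zify [this] at hs hconv ⊢
    nlinarith
  have ho' : #A * l ^ 2 ≤ 2 * o := by
    have h1 : l ^ 2 ≤ 2 * (l ^ 2 - l) := by
      have : 2 * l ≤ l ^ 2 := by nlinarith
      omega
    calc _ ≤ #A * (2 * (l ^ 2 - l)) := Nat.mul_le_mul_left _ h1
      _ = 2 * (#A * (l ^ 2 - l)) := by ring
      _ ≤ _ := Nat.mul_le_mul_left _ ho
  have hfin : l ^ 2 * (#A * l ^ 2) ≤ 2 * (n ^ 3 * Q) := by
    have h1 : l ^ 2 ≤ (2 * l - 2) ^ 2 := Nat.pow_le_pow_left (by omega) 2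
    calc _ ≤ (2 * l - 2) ^ 2 * (2 * o) := Nat.mul_le_mul h1 ho'
      _ = 2 * ((2 * l - 2) ^ 2 * o) := by ring
      _ ≤ _ := Nat.mul_le_mul_left _ (hoff.trans hup)
  have hAn : 16 * n * l ≤ #A := by nlinarith
  have : n * (16 * l ^ 5) ≤ n * (2 * (Q * n ^ 2)) := by
    calc _ = l ^ 2 * (16 * n * l * l ^ 2) := by ring
      _ ≤ l ^ 2 * (#A * l ^ 2) :=
        Nat.mul_le_mul_left _ (Nat.mul_le_mul_right _ hAn)
      _ ≤ 2 * (n ^ 3 * Q) := hfin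
      _ = _ := by ring
  have := Nat.le_of_mul_le_mul_left this hn
  omega

end SimpleGraph

theorem eq_zero_of_forall_sum_mul_pow_eq_zero {F : Type*} [Field F] {N : ℕ} (r : Fin N → F)
    (S : Finset F) (hS : N ≤ S.card) (h : ∀ x ∈ S, ∑ i, r i * x ^ (i : ℕ) = 0) (i : Fin N) :
    r i = 0 := by
  have hP : ∑ i, Polynomial.C (r i) * Polynomial.X ^ (i : ℕ) = 0 := by
    by_contra hne
    refine hne (Polynomial.eq_zero_of_degree_lt_of_eval_finset_eq_zero S ?_ ?_)
    · refine (Polynomial.degree_sum_fin_lt r).trans_le ?_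
      exact_mod_cast hS
    · intro x hx
      simpa [Polynomial.eval_finsetSum] using h x hx
  have := congrArg (fun P => Polynomial.coeff P i) hP
  simpa [Polynomial.finsetSum_coeff, Polynomial.coeff_C_mul, Polynomial.coeff_X_pow,
    Fin.val_inj] using this

/-- The resultant of two quadratics with a common root vanishes. -/
theorem resultant_quadratic_eq_zero {R : Type*} [CommRing R] {a b c a' b' c' y : R}
    (h : a * y ^ 2 + b * y + c = 0) (h' : a' * y ^ 2 + b' * y + c' = 0) :
    (a * c' - a' * c) ^ 2 = (a * b' - a' * b) * (b * c' - b' * c) := by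
  have h1 : (a * b' - a' * b) * y = a' * c - a * c' := by linear_combination a * h' - a' * h
  have h2 : (a * b' - a' * b) * y ^ 2 = b * c' - b' * c := by linear_combination b' * h - b * h'
  rw [← h2]
  linear_combination (a' * c - a * c' + (a * b' - a' * b) * y) * (-h1)

/-- The cubic curve `κα w² w̄ + κ̄ᾱ w w̄² + γ w w̄ + κα² w̄ + κ̄ᾱ² w = 0`, in the coordinates
`x = w` and `y = w̄`. -/
def combCubic {F : Type*} [Field F] (k K a A g x y : F) : F :=
  K * A * x * y ^ 2 + (k * a * x ^ 2 + g * x + k * a ^ 2) * y + K * A ^ 2 * x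

theorem combCubic_params_eq {F : Type*} [Field F] [CharP F 2] {k K a A b B g h : F}
    (hk : k ≠ 0) (hK : K ≠ 0) (ha : a ≠ 0) (hA : A ≠ 0) (hb : b ≠ 0) (hB : B ≠ 0)
    (hM : k ^ 2 * a ^ 3 ≠ K ^ 2 * A ^ 3) (σ : F → F) (S : Finset F) (hS : 5 ≤ S.card)
    (h0 : 0 ∉ S) (h1 : ∀ x ∈ S, combCubic k K a A g x (σ x) = 0)
    (h2 : ∀ x ∈ S, combCubic k K b B h x (σ x) = 0) : a = b ∧ g = h := by
  have two : (2 : F) = 0 := CharTwo.two_eq_zero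
  obtain ⟨l, rfl⟩ : ∃ l, b = l * a := ⟨b / a, by field_simp⟩
  obtain ⟨m, rfl⟩ : ∃ m, B = m * A := ⟨B / A, by field_simp⟩
  have hl : l ≠ 0 := left_ne_zero_of_mul hb
  have hm : m ≠ 0 := left_ne_zero_of_mul hB
  have key := eq_zero_of_forall_sum_mul_pow_eq_zero
    ![k ^ 2 * a ^ 4 * ((l ^ 2 + m) * (l ^ 2 + m ^ 2)),
      k * a ^ 2 * ((h + m * g) * (m ^ 2 + l ^ 2) + (l ^ 2 + m) * (g * m ^ 2 + h)),
      K ^ 2 * A ^ 3 * m ^ 2 * (1 + m) ^ 2 + k ^ 2 * a ^ 3 * ((l + m) * (m ^ 2 + l ^ 2) +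
        (l ^ 2 + m) * (m ^ 2 + l)) + (h + m * g) * (g * m ^ 2 + h),
      k * a * ((h + m * g) * (m ^ 2 + l) + (l + m) * (g * m ^ 2 + h)),
      k ^ 2 * a ^ 2 * ((l + m) * (m ^ 2 + l))] S hS ?_
  · have r0 : (l ^ 2 + m) * (l ^ 2 + m ^ 2) = 0 := by simpa [hk, ha] using key 0
    have r1 : (h + m * g) * (m ^ 2 + l ^ 2) + (l ^ 2 + m) * (g * m ^ 2 + h) = 0 := by
      simpa [hk, ha] using key 1
    have r2 : K ^ 2 * A ^ 3 * m ^ 2 * (1 + m) ^ 2 + k ^ 2 * a ^ 3 * ((l + m) * (m ^ 2 + l ^ 2) +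
        (l ^ 2 + m) * (m ^ 2 + l)) + (h + m * g) * (g * m ^ 2 + h) = 0 := key 2
    have r3 : (h + m * g) * (m ^ 2 + l) + (l + m) * (g * m ^ 2 + h) = 0 := by
      simpa [hk, ha] using key 3
    have r4 : (l + m) * (m ^ 2 + l) = 0 := 
      (mul_eq_zero.1 (show k ^ 2 * a ^ 2 * ((l + m) * (m ^ 2 + l)) = 0 from key 4)).resolve_left
        (by simp [hk, ha])
    have e1 : l = m → a = l * a ∧ g = h := by
      rintro rfl
      by_cases hl1 : l = 1
      · subst hl1
        have : (g + h) ^ 2 = 0 := by grind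
        have : g + h = 0 := by simpa using this
        grind
      · exfalso
        have hll : l ^ 2 + l ≠ 0 := by grind
        have s3 : h + l * g = 0 := by grind
        have s1 : g * l ^ 2 + h = 0 := by grind
        have : g = 0 := by grind
        grind
    by_cases hlm : l = m
    · exact e1 hlm
    · exfalso
      have hlm' : l + m ≠ 0 := by grind
      have s4 : m ^ 2 + l = 0 := by grind
      have s0 : l ^ 2 + m = 0 := by grind
      have : l + m = 1 := by grind
      have s3 : g * m ^ 2 + h = 0 := by grind
      have s1 : h + m * g = 0 := by grind
      grind
  · intro x hx
    have hx0 : x ≠ 0 := fun h => h0 (h ▸ hx)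
    have hres := resultant_quadratic_eq_zero (h1 x hx) (h2 x hx)
    have : x ^ 2 * K ^ 2 * A ^ 3 ≠ 0 := by positivity
    apply mul_left_cancel₀ this
    simp only [Fin.sum_univ_five, Matrix.cons_val, Fin.coe_ofNat_eq_mod,
      mul_zero, Fin.isValue]
    norm_num1
    have four : (4 : F) = 0 := by linear_combination 2 * two
    linear_combination (norm := (ring_nf; simp [two, four])) hres

theorem coeff_eq_zero_of_sq_add_mul_eq_zero {F : Type*} [Field F] [CharP F 2]
    (u0 u1 u2 v0 v1 v2 v3 w0 w1 w2 w3 w4 : F) (S : Finset F) (hS : 8 ≤ S.card)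
    (h : ∀ x ∈ S, (x * (u2 * x ^ 2 + u1 * x + u0)) ^ 2 +
      (v3 * x ^ 3 + v2 * x ^ 2 + v1 * x + v0) *
        (w4 * x ^ 4 + w3 * x ^ 3 + w2 * x ^ 2 + w1 * x + w0) = 0) :
    v3 * w4 = 0 ∧ v3 * w3 + v2 * w4 + u2 ^ 2 = 0 ∧
      ∀ x, (x * (u2 * x ^ 2 + u1 * x + u0)) ^ 2 +
        (v3 * x ^ 3 + v2 * x ^ 2 + v1 * x + v0) *
          (w4 * x ^ 4 + w3 * x ^ 3 + w2 * x ^ 2 + w1 * x + w0) = 0 := by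
  have two : (2 : F) = 0 := CharTwo.two_eq_zero
  let r : Fin 8 → F := ![v0 * w0, v1 * w0 + v0 * w1, v2 * w0 + v1 * w1 + v0 * w2 + u0 ^ 2,
      v3 * w0 + v2 * w1 + v1 * w2 + v0 * w3,
      v3 * w1 + v2 * w2 + v1 * w3 + v0 * w4 + u1 ^ 2, v3 * w2 + v2 * w3 + v1 * w4,
      v3 * w3 + v2 * w4 + u2 ^ 2, v3 * w4]
  have expand : ∀ x, ∑ i, r i * x ^ (i : ℕ) = (x * (u2 * x ^ 2 + u1 * x + u0)) ^ 2 +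
      (v3 * x ^ 3 + v2 * x ^ 2 + v1 * x + v0) *
        (w4 * x ^ 4 + w3 * x ^ 3 + w2 * x ^ 2 + w1 * x + w0) := by
    intro x
    simp only [r, Fin.sum_univ_eight, Matrix.cons_val, Fin.coe_ofNat_eq_mod, Fin.isValue]
    norm_num1
    linear_combination (-(u1 * u0 * x ^ 3 + u2 * u0 * x ^ 4 + u2 * u1 * x ^ 5)) * two
  have key := eq_zero_of_forall_sum_mul_pow_eq_zero r S hS fun x hx => (expand x).trans (h x hx)
  exact ⟨key 7, key 6, fun x => by rw [← expand]; simp [key]⟩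

theorem coeff_eq_zero_of_mul_sq_add_mul_eq_zero {F : Type*} [Field F] [CharP F 2]
    (c u0 u1 u2 v0 v1 v2 w0 w1 w2 w3 : F) (S : Finset F) (hS : 6 ≤ S.card)
    (h : ∀ x ∈ S, c * x * (u2 * x ^ 2 + u1 * x + u0) ^ 2 +
      (v2 * x ^ 2 + v1 * x + v0) * (w3 * x ^ 3 + w2 * x ^ 2 + w1 * x + w0) = 0) :
    v0 * w0 = 0 ∧ c * u0 ^ 2 + v1 * w0 + v0 * w1 = 0 := by
  have two : (2 : F) = 0 := CharTwo.two_eq_zero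
  have key := eq_zero_of_forall_sum_mul_pow_eq_zero
    ![v0 * w0, c * u0 ^ 2 + v1 * w0 + v0 * w1, v2 * w0 + v1 * w1 + v0 * w2,
      c * u1 ^ 2 + v2 * w1 + v1 * w2 + v0 * w3, v2 * w2 + v1 * w3, c * u2 ^ 2 + v2 * w3]
    S hS ?_
  · exact ⟨key 0, key 1⟩
  · intro x hx
    simp only [Fin.sum_univ_six, Matrix.cons_val, Fin.coe_ofNat_eq_mod, Fin.isValue]
    norm_num1
    linear_combination h x hx -
      c * (u1 * u0 * x ^ 2 + u2 * u0 * x ^ 3 + u2 * u1 * x ^ 4) * two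

/-- Translates of two cubics of the family by a vector off the axes have few common points. -/
theorem not_combCubic_translate {F : Type*} [Field F] [CharP F 2] {k K a A b B g h t s : F}
    (hk : k ≠ 0) (hK : K ≠ 0) (ha : a ≠ 0) (hA : A ≠ 0) (hb : b ≠ 0) (hB : B ≠ 0)
    (hM : k ^ 2 * a ^ 3 ≠ K ^ 2 * A ^ 3) (ht : t ≠ 0) (hs : s ≠ 0)
    (σ : F → F) (S : Finset F) (hS : 8 ≤ S.card) (h0 : 0 ∉ S)
    (h1 : ∀ x ∈ S, combCubic k K a A g x (σ x) = 0)
    (h2 : ∀ x ∈ S, combCubic k K b B h (x + t) (σ x + s) = 0) : False := by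
  have two : (2 : F) = 0 := CharTwo.two_eq_zero
  obtain ⟨l, rfl⟩ : ∃ l, b = l * a := ⟨b / a, by field_simp⟩
  obtain ⟨m, rfl⟩ : ∃ m, B = m * A := ⟨B / A, by field_simp⟩
  have hl : l ≠ 0 := left_ne_zero_of_mul hb
  have hm : m ≠ 0 := left_ne_zero_of_mul hB
  obtain ⟨p, hp⟩ : ∃ p, p = k * a := ⟨_, rfl⟩
  obtain ⟨P, hP⟩ : ∃ P, P = K * A := ⟨_, rfl⟩
  obtain ⟨d, hd⟩ : ∃ d, d = k * a ^ 2 := ⟨_, rfl⟩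
  obtain ⟨D, hD⟩ : ∃ D, D = K * A ^ 2 := ⟨_, rfl⟩
  have hp0 : p ≠ 0 := by simp [hp, hk, ha]
  have hP0 : P ≠ 0 := by simp [hP, hK, hA]
  have hd0 : d ≠ 0 := by simp [hd, hk, ha]
  have hD0 : D ≠ 0 := by simp [hD, hK, hA]
  have hM' : p * d + P * D ≠ 0 := by
    intro h
    apply hM
    subst hp hP hd hD
    linear_combination h - K ^ 2 * A ^ 3 * two
  have e1 : ∀ x ∈ S, P * x * σ x ^ 2 + (p * x ^ 2 + g * x + d) * σ x + D * x = 0 := by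
    intro x hx
    rw [← h1 x hx, combCubic, hp, hP, hd, hD]
  have e2 : ∀ x ∈ S, m * P * (x + t) * (σ x + s) ^ 2 +
      (l * p * (x + t) ^ 2 + h * (x + t) + l ^ 2 * d) * (σ x + s) + m ^ 2 * D * (x + t) = 0 := by
    intro x hx
    rw [← h2 x hx, combCubic, hp, hP, hd, hD]
    ring
  clear h1 h2 hp hP hd hD hM
  obtain ⟨c1, hc1⟩ : ∃ c, c = m * P * s ^ 2 + m ^ 2 * D + h * s := ⟨_, rfl⟩
  obtain ⟨d0, hd0'⟩ : ∃ c, c = l * p * t ^ 2 + h * t + l ^ 2 * d := ⟨_, rfl⟩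
  obtain ⟨c0, hc0⟩ : ∃ c, c = l * p * s * t ^ 2 + c1 * t + s * (l ^ 2 * d) := ⟨_, rfl⟩
  have e2' : ∀ x ∈ S, m * P * (x + t) * σ x ^ 2 + (l * p * x ^ 2 + h * x + d0) * σ x +
      (l * p * s * x ^ 2 + c1 * x + c0) = 0 := by
    intro x hx
    rw [← e2 x hx, hc0, hd0', hc1]
    linear_combination (-(m * P * (x + t) * σ x * s + l * p * x * t * (σ x + s))) * two
  obtain ⟨r7, r6, r⟩ := coeff_eq_zero_of_sq_add_mul_eq_zero
    (P * c0 + m * P * D * t) (P * c1 + m * P * D) (P * (l * p) * s)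
    (m * P * t * d) (P * d0 + m * P * (d + t * g)) (P * h + m * P * (g + t * p))
    (P * (l * p) + m * P * p)
    (d * c0) (g * c0 + d * c1 + D * d0) (p * c0 + g * c1 + d * (l * p) * s + D * h)
    (p * c1 + g * (l * p) * s + D * (l * p)) (p * (l * p) * s) S hS (by
      intro x hx
      have hres := resultant_quadratic_eq_zero (e1 x hx) (e2' x hx)
      linear_combination (norm := (ring_nf; reduce_mod_char!)) hres)
  clear e2
  have hlm : l = m := by
    have h3 : P * p ^ 2 * l * p * s ≠ 0 := by simp [*]
    have h4 : P * p ^ 2 * l * p * s * (l + m) = 0 := by linear_combination r7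
    exact CharTwo.add_eq_zero.1 ((mul_eq_zero.1 h4).resolve_left h3)
  subst hlm
  have rh : h = l * (g + (p * t + P * s)) := by
    have h3 : P * p ^ 2 * l * s ≠ 0 := by simp [*]
    have h4 : P * p ^ 2 * l * s * (h + l * (g + (p * t + P * s))) = 0 := by
      linear_combination r6 - P * l * p * (p * c1 + g * (l * p) * s + D * (l * p)) * two
    exact CharTwo.add_eq_zero.1 ((mul_eq_zero.1 h4).resolve_left h3)
  clear r6 r7
  have rc0 : c0 = 0 := by
    have h3 : l * P * t * d ^ 2 ≠ 0 := by simp [*]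
    refine (mul_eq_zero.1 (?_ : l * P * t * d ^ 2 * c0 = 0)).resolve_left h3
    linear_combination r 0
  have rt : P * t * s ^ 2 + (p * t ^ 2 + g * t + d) * s + D * t = 0 := by
    have h3 : P * t * l ^ 4 * d ^ 2 ≠ 0 := by simp [*]
    refine (mul_eq_zero.1 (?_ : P * t * l ^ 4 * d ^ 2 * _ = 0)).resolve_left h3
    have := r t
    rw [hc0, hd0', hc1] at this
    linear_combination (norm := (ring_nf; reduce_mod_char!)) this
  have hts : t * s ≠ 0 := mul_ne_zero ht hs
  have hE : d * s + D * t = t * s * (p * t + P * s + g) := by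
    linear_combination rt - (P * t * s ^ 2 + p * t ^ 2 * s + g * t * s) * two
  have hg : g = l * (p * t + P * s + g) := by
    apply mul_left_cancel₀ hts
    apply mul_left_cancel₀ hl
    rw [hc0, hc1, rh] at rc0
    linear_combination (norm := (ring_nf; reduce_mod_char!)) rc0 - l ^ 2 * hE
  obtain ⟨τ, hτ⟩ : ∃ τ, τ = p * t + P * s := ⟨_, rfl⟩
  obtain ⟨e, he⟩ : ∃ e, e = p * t ^ 2 + (g + τ) * t + (1 + l) * d := ⟨_, rfl⟩
  obtain ⟨e', he'⟩ : ∃ e, e = P * s ^ 2 + (g + τ) * s + (1 + l) * D := ⟨_, rfl⟩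
  obtain ⟨q0, q1⟩ := coeff_eq_zero_of_mul_sq_add_mul_eq_zero P (t * D) e' (p * s)
    (t * d) (e + t * g) (P * s) (d * e' + D * e) (g * e' + d * p * s + D * τ)
    (p * e' + g * p * s) (p * (p * s)) S (by omega) (by
      intro x hx
      have hx0 : x ≠ 0 := fun h => h0 (h ▸ hx)
      have eQ : t * P * σ x ^ 2 + (τ * x + e) * σ x + x * (p * s * x + e') = 0 := by
        apply mul_left_cancel₀ hl
        have h1 := e1 x hx
        have h2 := e2' x hx
        rw [rc0, hd0', hc1, rh, ← hτ] at h2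
        rw [he, he']
        linear_combination h2 + l * h1 - l * (P * x * σ x ^ 2 + (p * x ^ 2 + g * x) * σ x) * two
      have hres := resultant_quadratic_eq_zero (e1 x hx) eQ
      apply mul_left_cancel₀ (mul_ne_zero hP0 hx0)
      rw [hτ] at hres ⊢
      linear_combination (norm := (ring_nf; reduce_mod_char!)) hres)
  obtain ⟨ρ, rfl⟩ : ∃ ρ, e = d * ρ := ⟨e / d, by field_simp⟩
  have q0' : e' = D * ρ := by
    have h3 : t * d * d ≠ 0 := by simp [*]
    apply mul_left_cancel₀ h3
    linear_combination q0 - t * d * d * D * ρ * two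
  subst q0'
  have q2 : g * d * D * ρ = (p * d + P * D) * (d * s + D * t) := by
    apply mul_left_cancel₀ ht
    rw [hτ] at q1
    linear_combination (norm := (ring_nf; reduce_mod_char!)) q1
  have q3 : t * s * τ = (d * s + D * t) * (ρ + 1 + l) := by
    rw [hτ] at he he' ⊢
    linear_combination (norm := (ring_nf; reduce_mod_char!)) s * he + t * he'
  rw [← hτ] at hE hg
  have q4 : τ = (τ + g) * (ρ + 1 + l) := by
    apply mul_left_cancel₀ hts
    rw [q3, hE]
    ring
  by_cases hg0 : g = 0
  · rw [hg0, add_zero] at hg hE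
    have hτ0 : τ = 0 := (mul_eq_zero.1 hg.symm).resolve_left hl
    rw [hτ0, mul_zero] at hE
    apply hM'
    apply mul_left_cancel₀ ht
    linear_combination P * hE + d * hτ0 - d * hτ - P * s * d * two
  · have hτg : τ + g ≠ 0 := fun h => hg0 (by rw [hg, h, mul_zero])
    have hρ : ρ = 0 := by
      apply mul_left_cancel₀ hg0
      linear_combination (norm := (ring_nf; reduce_mod_char!)) l * q4 + (ρ + 1 + l) * hg + hg
    rw [hρ, mul_zero] at q2
    have h5 := (mul_eq_zero.1 q2.symm).resolve_left hM'
    exact mul_ne_zero hts hτg (hE.symm.trans h5)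

theorem combCubic_eq_zero {K : Type*} [Field K] [CharP K 2] (σ : K →+* K) (κ w z : K) :
    combCubic κ (σ κ) (w * z) (σ (w * z)) (κ * (w ^ 2 * z + w * z ^ 2) +
      σ (κ * (w ^ 2 * z + w * z ^ 2))) w (σ w) = 0 := by
  simp only [combCubic, map_mul, map_add, map_pow]
  ring_nf
  reduce_mod_char!

/-- Two cubics `combCubic κ (σ κ) α (σ α) γ`, one of them translated by `t`, can share `8` points
`(x, σ x)` only when they are equal and `t = 0`. -/
theorem combCubic_rigid {K : Type*} [Field K] [CharP K 2] (σ : K →+* K) {κ α β γ δ t : K}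
    (hκ : κ ≠ 0) (hM : ∀ x ≠ 0, κ ^ 2 * x ^ 3 ≠ σ (κ ^ 2 * x ^ 3)) (hα : α ≠ 0) (hβ : β ≠ 0)
    (S : Finset K) (hS : 8 ≤ S.card) (h0 : 0 ∉ S)
    (h1 : ∀ x ∈ S, combCubic κ (σ κ) α (σ α) γ x (σ x) = 0)
    (h2 : ∀ x ∈ S, combCubic κ (σ κ) β (σ β) δ (x + t) (σ (x + t)) = 0) :
    t = 0 ∧ α = β ∧ γ = δ := by
  have ne : ∀ x ≠ 0, σ x ≠ 0 := fun x hx => (map_ne_zero σ).2 hx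
  have hM' := hM α hα
  simp only [map_mul, map_pow] at hM'
  by_cases ht : t = 0
  · subst ht
    simp only [add_zero] at h2
    exact ⟨rfl, combCubic_params_eq hκ (ne _ hκ) hα (ne _ hα) hβ (ne _ hβ) hM' σ S (by omega) h0
      h1 h2⟩
  · simp only [map_add] at h2
    exact (not_combCubic_translate hκ (ne _ hκ) hα (ne _ hα) hβ (ne _ hβ) hM' ht (ne _ ht) σ S hS
      h0 h1 h2).elim

section CombGraph

variable {F K : Type*} [Field F] [Field K] [Algebra F K]

/-- The symmetric relation `x + y = uv`, `ξ + η = Tr (κ (u² v + u v²))` between the triples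
`(u, x, ξ)` and `(v, y, η)`. -/
def combRel (κ : K) (a b : K × K × F) : Prop :=
  a.2.1 + b.2.1 = a.1 * b.1 ∧
    a.2.2 + b.2.2 = Algebra.trace F K (κ * (a.1 ^ 2 * b.1 + a.1 * b.1 ^ 2))

theorem combRel.symm {κ : K} {a b : K × K × F} (h : combRel κ a b) : combRel κ b a :=
  ⟨by rw [add_comm, h.1, mul_comm], by rw [add_comm, h.2]; congr 2; ring⟩

theorem combRel.eq_of_fst_eq {κ : K} {a b c : K × K × F} (hb : combRel κ a b)
    (hc : combRel κ a c) (h : b.1 = c.1) : b = c := by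
  refine Prod.ext h (Prod.ext ?_ ?_)
  · exact add_left_cancel (hb.1.trans (by rw [h, hc.1]))
  · exact add_left_cancel (hb.2.trans (by rw [h, hc.2]))

/-- The bipartite graph on two copies of `K × K × F` whose edges are given by `combRel κ`. -/
def combGraph (F : Type*) {K : Type*} [Field F] [Field K] [Algebra F K] (κ : K) :
    SimpleGraph (Bool × (K × K × F)) where
  Adj a b := a.1 ≠ b.1 ∧ combRel κ a.2 b.2
  symm := ⟨fun _ _ h => ⟨h.1.symm, h.2.symm⟩⟩
  loopless := ⟨fun _ h => h.1 rfl⟩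

/-- The first coordinates along a walk `a' a b b'` determine a factorization of a quantity that
depends on the ends only. -/
theorem combRel.path [CharP K 2] [CharP F 2] {κ : K} {a' a b b' : K × K × F}
    (h1 : combRel κ a' a) (h2 : combRel κ a b) (h3 : combRel κ b b') :
    (a'.1 + b.1) * (a.1 + b'.1) = a'.2.1 + b'.2.1 + a'.1 * b'.1 ∧
    Algebra.trace F K (κ * ((a'.1 + b.1) ^ 2 * (a.1 + b'.1) + (a'.1 + b.1) * (a.1 + b'.1) ^ 2)) =
      a'.2.2 + b'.2.2 + Algebra.trace F K (κ * (a'.1 ^ 2 * b'.1 + a'.1 * b'.1 ^ 2)) := by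
  constructor
  · have e1 := h1.1
    have e2 := h2.1
    have e3 := h3.1
    linear_combination (norm := (ring_nf; reduce_mod_char!)) e1 + e2 + e3
  · have e1 := h1.2
    have e2 := h2.2
    have e3 := h3.2
    have : κ * ((a'.1 + b.1) ^ 2 * (a.1 + b'.1) + (a'.1 + b.1) * (a.1 + b'.1) ^ 2) =
        κ * (a'.1 ^ 2 * a.1 + a'.1 * a.1 ^ 2) + κ * (a.1 ^ 2 * b.1 + a.1 * b.1 ^ 2) +
        κ * (b.1 ^ 2 * b'.1 + b.1 * b'.1 ^ 2) + κ * (a'.1 ^ 2 * b'.1 + a'.1 * b'.1 ^ 2) := by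
      ring_nf
      reduce_mod_char!
    rw [this, map_add, map_add, map_add, ← e1, ← e2, ← e3]
    ring_nf
    reduce_mod_char!

end CombGraph

theorem exists_mul_pow_three_ne_pow_card {F K : Type*} [Field F] [Field K] [Algebra F K]
    [Finite F] [Finite K] (hFK : Module.finrank F K = 2) {k : ℕ} (hk : Odd k)
    (hF : Nat.card F = 2 ^ k) :
    ∃ κ : K, κ ≠ 0 ∧ ∀ x ≠ 0, κ ^ 2 * x ^ 3 ≠ (κ ^ 2 * x ^ 3) ^ Nat.card F := by
  have hK : Nat.card K = Nat.card F ^ 2 := by rw [Module.natCard_eq_pow_finrank (K := F), hFK]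
  have hmod : 3 ∣ Nat.card F + 1 := by
    obtain ⟨j, rfl⟩ := hk
    rw [hF, pow_succ, pow_mul, Nat.dvd_iff_mod_eq_zero, Nat.add_mod, Nat.mul_mod, Nat.pow_mod]
    norm_num
  obtain ⟨c, hc⟩ := hmod
  set q := Nat.card F with hq
  have hq1 : 1 < q := Finite.one_lt_card
  have hcard : Nat.card Kˣ = (q - 1) * (3 * c) := by
    rw [Nat.card_units, hK, ← hc]
    simpa [mul_comm] using Nat.sq_sub_sq q 1
  obtain ⟨g, hg⟩ := IsCyclic.exists_generator (α := Kˣ)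
  have hord := orderOf_eq_card_of_forall_mem_zpowers hg
  refine ⟨g, g.ne_zero, fun x hx heq => ?_⟩
  lift x to Kˣ using hx.isUnit
  have h1 : g ^ 2 * x ^ 3 = (g ^ 2 * x ^ 3) ^ q := by exact_mod_cast heq
  have h2 : (g ^ 2 * x ^ 3) ^ (q - 1) = 1 := by
    apply mul_right_cancel (b := g ^ 2 * x ^ 3)
    rw [← pow_succ, Nat.sub_add_cancel hq1.le, one_mul, ← h1]
  have h3 : x ^ (3 * ((q - 1) * c)) = 1 := by
    rw [show 3 * ((q - 1) * c) = Nat.card Kˣ by rw [hcard]; ring, pow_card_eq_one']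
  have h4 : g ^ (2 * ((q - 1) * c)) = 1 := by
    calc g ^ (2 * ((q - 1) * c)) = ((g ^ 2 * x ^ 3) ^ (q - 1)) ^ c := by
          rw [← pow_mul, mul_pow, ← pow_mul, ← pow_mul, h3, mul_one]
      _ = 1 := by rw [h2, one_pow]
  have h5 := orderOf_dvd_of_pow_eq_one h4
  rw [hord, hcard] at h5
  have hm : 0 < (q - 1) * c := Nat.mul_pos (by omega) (by lia)
  have := Nat.le_of_dvd (by omega) h5
  have h6 : (q - 1) * (3 * c) = 3 * ((q - 1) * c) := by ring
  omega

section CombGraphFree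

variable {F K : Type*} [Field F] [Field K] [Algebra F K]

theorem card_pow_seven_le_ncard_edgeSet_combGraph [Finite F] [Finite K]
    (hFK : Module.finrank F K = 2) (κ : K) :
    Nat.card F ^ 7 ≤ (combGraph F κ).edgeSet.ncard := by
  have hK : Nat.card K = Nat.card F ^ 2 := by rw [Module.natCard_eq_pow_finrank (K := F), hFK]
  let y : (K × K × F) × K → K × K × F := fun a => (a.2, a.1.1 * a.2 - a.1.2.1,
    Algebra.trace F K (κ * (a.1.1 ^ 2 * a.2 + a.1.1 * a.2 ^ 2)) - a.1.2.2)
  let φ : (K × K × F) × K → (combGraph F κ).edgeSet := fun a =>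
    ⟨s((false, a.1), (true, y a)), by simp [combGraph, combRel, y]⟩
  have hφ : Function.Injective φ := by
    intro a b h
    have h' : s((false, a.1), (true, y a)) = s((false, b.1), (true, y b)) := congrArg Subtype.val h
    simp only [Sym2.eq_iff, Prod.mk.injEq, Bool.false_eq_true, Bool.true_eq_false, true_and,
      false_and, and_false, or_false] at h'
    exact Prod.ext h'.1 (congrArg Prod.fst h'.2)
  have := Nat.card_le_card_of_injective φ hφ
  rw [Nat.card_coe_set_eq] at this
  refine le_trans (le_of_eq ?_) this
  simp only [Nat.card_prod, hK]
  ring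

theorem combPasting_adj_root {p : ℕ} (i : Fin p) (j : Fin 3) :
    (combPasting p).Adj (Sum.inl j) (Sum.inr (i, j)) := by
  simp [combPasting]

theorem combPasting_adj_path {p : ℕ} (i : Fin p) {j j' : Fin 3} (h : (j' : ℕ) = j + 1) :
    (combPasting p).Adj (Sum.inr (i, j)) (Sum.inr (i, j')) := by
  have : j ≠ j' := by rintro rfl; omega
  simp [combPasting, h, this]

theorem not_contains_combPasting_combGraph [Finite F] [Finite K] [CharP F 2] [CharP K 2]
    (hFK : Module.finrank F K = 2) {κ : K} (hκ : κ ≠ 0)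
    (hM : ∀ x ≠ 0, κ ^ 2 * x ^ 3 ≠ (κ ^ 2 * x ^ 3) ^ Nat.card F) {p : ℕ} (hp : 8 ≤ p) :
    ¬ (combGraph F κ).Contains (combPasting p) := by
  classical
  rintro ⟨f, hf⟩
  have := Fintype.ofFinite F
  let σ : K →+* K := (FiniteField.frobeniusAlgHom F K : K →+* K)
  have hσ : ∀ x, σ x = x ^ Nat.card F := fun x => by
    rw [Nat.card_eq_fintype_card]; rfl
  have hTr : ∀ x : K, algebraMap F K (Algebra.trace F K x) = x + σ x := fun x => by
    rw [FiniteField.algebraMap_trace_eq_sum_pow, hFK, hσ]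
    simp [Finset.sum_range_succ]
  let A := f (Sum.inl 0)
  let B := f (Sum.inl 1)
  let C := f (Sum.inl 2)
  let a i := f (Sum.inr (i, 0))
  let b i := f (Sum.inr (i, 1))
  let c i := f (Sum.inr (i, 2))
  have hAa i : (combGraph F κ).Adj A (a i) := f.map_adj (combPasting_adj_root i 0)
  have hBb i : (combGraph F κ).Adj B (b i) := f.map_adj (combPasting_adj_root i 1)
  have hCc i : (combGraph F κ).Adj C (c i) := f.map_adj (combPasting_adj_root i 2)
  have hab i : (combGraph F κ).Adj (a i) (b i) := f.map_adj (combPasting_adj_path i rfl)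
  have hbc i : (combGraph F κ).Adj (b i) (c i) := f.map_adj (combPasting_adj_path i rfl)
  have det : ∀ x y z, (combGraph F κ).Adj x y → (combGraph F κ).Adj x z → y.2.1 = z.2.1 →
      y = z := by
    intro x y z hy hz h
    refine Prod.ext ?_ (hy.2.eq_of_fst_eq hz.2 h)
    have h1 := hy.1
    have h2 := hz.1
    revert h1 h2
    generalize x.1 = x1, y.1 = y1, z.1 = z1
    revert x1 y1 z1
    decide
  -- the quantities attached to a root `R` of a leg `R, r, b i`
  let α (R : Bool × (K × K × F)) : K := R.2.2.1 + B.2.2.1 + R.2.1 * B.2.1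
  let γ (R : Bool × (K × K × F)) : F := R.2.2.2 + B.2.2.2 +
    Algebra.trace F K (κ * (R.2.1 ^ 2 * B.2.1 + R.2.1 * B.2.1 ^ 2))
  have leg : ∀ R r i, (combGraph F κ).Adj R r → (combGraph F κ).Adj r (b i) → R ≠ b i → r ≠ B →
      R.2.1 + (b i).2.1 ≠ 0 ∧ α R ≠ 0 ∧ combCubic κ (σ κ) (α R) (σ (α R))
        (algebraMap F K (γ R)) (R.2.1 + (b i).2.1) (σ (R.2.1 + (b i).2.1)) = 0 := by
    intro R r i h1 h2 h3 h4
    obtain ⟨e1, e2⟩ := h1.2.path h2.2 (hBb i).2.symm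
    have hw : R.2.1 + (b i).2.1 ≠ 0 := fun h =>
      h3 (det r _ _ h1.symm h2 (CharTwo.add_eq_zero.1 h))
    have hz : r.2.1 + B.2.1 ≠ 0 := fun h =>
      h4 (det (b i) _ _ h2.symm (hBb i).symm (CharTwo.add_eq_zero.1 h))
    have e1' : (R.2.1 + (b i).2.1) * (r.2.1 + B.2.1) = α R := e1
    have e2' : _ = γ R := e2
    refine ⟨hw, e1' ▸ mul_ne_zero hw hz, ?_⟩
    rw [← e1', ← e2', hTr]
    exact combCubic_eq_zero σ κ _ _
  have ne : ∀ {x y}, x ≠ y → f x ≠ f y := fun h h' => h (hf h')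
  have legA i := leg A (a i) i (hAa i) (hab i) (ne (by simp)) (ne (by simp))
  have legC i := leg C (c i) i (hCc i) (hbc i).symm (ne (by simp)) (ne (by simp))
  have binj : Function.Injective fun i => A.2.1 + (b i).2.1 := by
    intro i j h
    have := hf (det B _ _ (hBb i) (hBb j) (add_left_cancel h))
    simpa using this
  let i₀ : Fin p := ⟨0, by omega⟩
  obtain ⟨ht, h1, h2⟩ := combCubic_rigid σ (t := A.2.1 + C.2.1) hκ
    (fun x hx => by rw [hσ]; exact hM x hx) (legA i₀).2.1 (legC i₀).2.1
    (Finset.univ.image fun i => A.2.1 + (b i).2.1)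
    (by rw [Finset.card_image_of_injective _ binj]; simpa using hp)
    (by
      simp only [Finset.mem_image, Finset.mem_univ, true_and, not_exists]
      exact fun i => (legA i).1)
    (by
      simp only [Finset.mem_image, Finset.mem_univ, true_and, forall_exists_index,
        forall_apply_eq_imp_iff]
      exact fun i => (legA i).2.2)
    (by
      simp only [Finset.mem_image, Finset.mem_univ, true_and, forall_exists_index,
        forall_apply_eq_imp_iff]
      intro i
      have : A.2.1 + (b i).2.1 + (A.2.1 + C.2.1) = C.2.1 + (b i).2.1 := by
        ring_nf
        reduce_mod_char!
      rw [this]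
      exact (legC i).2.2)
  have hu : A.2.1 = C.2.1 := CharTwo.add_eq_zero.1 ht
  have hx : A.2.2.1 = C.2.2.1 := by
    simp only [α, hu] at h1
    exact add_right_cancel (add_right_cancel h1)
  have hξ : A.2.2.2 = C.2.2.2 := by
    have h2 := FaithfulSMul.algebraMap_injective F K h2
    simp only [γ, hu] at h2
    exact add_right_cancel (add_right_cancel h2)
  have hside : A.1 = C.1 := by
    have h1 := (hAa i₀).1
    have h2 := (hab i₀).1
    have h3 := (hbc i₀).1
    have h4 := (hCc i₀).1
    revert h1 h2 h3 h4
    generalize A.1 = x1, (a i₀).1 = x2, (b i₀).1 = x3, (c i₀).1 = x4, C.1 = x5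
    revert x1 x2 x3 x4 x5
    decide
  have : A = C := Prod.ext hside (Prod.ext hu (Prod.ext hx hξ))
  exact absurd (hf this) (by simp)

end CombGraphFree

theorem exists_adj_combPasting {p : ℕ} (hp : 0 < p) (x : Fin 3 ⊕ (Fin p × Fin 3)) :
    ∃ y, (combPasting p).Adj x y := by
  obtain j | ⟨i, j⟩ := x
  · exact ⟨_, combPasting_adj_root ⟨0, hp⟩ j⟩
  · exact ⟨_, (combPasting_adj_root i j).symm⟩

theorem SimpleGraph.contains_of_contains_map {V W β : Type*} {G : SimpleGraph V}
    {H : SimpleGraph β} (hH : ∀ x, ∃ y, H.Adj x y) (e : V ↪ W) (h : (G.map e).Contains H) :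
    G.Contains H := by
  obtain ⟨f, hf⟩ := h
  have hex : ∀ x, ∃ v, e v = f x := by
    intro x
    obtain ⟨y, hy⟩ := hH x
    obtain ⟨v, -, -, hv, -⟩ := (SimpleGraph.map_adj _ _ _ _).1 (f.map_adj hy)
    exact ⟨v, hv⟩
  choose g hg using hex
  refine ⟨⟨g, fun {x y} hxy => ?_⟩, fun x y hxy => hf ?_⟩
  · have := f.map_adj hxy
    rwa [← hg, ← hg, SimpleGraph.map_adj_apply] at this
  · rw [← hg, ← hg]
    exact congrArg e hxy

theorem bddAbove_exNum {β : Type*} (n : ℕ) (H : SimpleGraph β) :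
    BddAbove {N : ℕ | ∃ G : SimpleGraph (Fin n), ¬ G.Contains H ∧ G.edgeSet.ncard = N} := by
  refine ⟨Nat.card (Sym2 (Fin n)), ?_⟩
  rintro _ ⟨G, -, rfl⟩
  exact Set.ncard_le_card _

theorem ncard_edgeSet_le_exNum {V β : Type*} [Finite V] {n : ℕ} (hn : Nat.card V ≤ n)
    {H : SimpleGraph β} (hH : ∀ x, ∃ y, H.Adj x y) {G : SimpleGraph V} (hG : ¬ G.Contains H) :
    G.edgeSet.ncard ≤ exNum n H := by
  have := Fintype.ofFinite V
  obtain ⟨e⟩ : Nonempty (V ↪ Fin n) := by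
    rw [Function.Embedding.nonempty_iff_card_le]
    simpa using hn
  refine le_csSup (bddAbove_exNum n H)
    ⟨G.map e, fun h => hG (SimpleGraph.contains_of_contains_map hH e h), ?_⟩
  rw [SimpleGraph.edgeSet_map, Set.ncard_image_of_injective _ e.sym2Map.injective]

theorem two_pow_le_exNum_combPasting {p n k : ℕ} (hp : 8 ≤ p) (hk : Odd k)
    (hn : 2 * (2 ^ k) ^ 5 ≤ n) : (2 ^ k) ^ 7 ≤ exNum n (combPasting p) := by
  let F := GaloisField 2 k
  let K := FiniteField.Extension F 2 2
  have hF : Nat.card F = 2 ^ k := GaloisField.card 2 k hk.pos.ne'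
  have hFK : Module.finrank F K = 2 := FiniteField.finrank_extension F 2 2
  have : CharP K 2 := charP_of_injective_algebraMap (FaithfulSMul.algebraMap_injective F K) 2
  have : Finite K := Module.finite_of_finite F
  obtain ⟨κ, hκ, hM⟩ := exists_mul_pow_three_ne_pow_card hFK hk hF
  rw [← hF]
  refine (card_pow_seven_le_ncard_edgeSet_combGraph hFK κ).trans
    (ncard_edgeSet_le_exNum ?_ (exists_adj_combPasting (by omega))
      (not_contains_combPasting_combGraph hFK hκ hM hp))
  refine le_trans (le_of_eq ?_) hn
  have hK : Nat.card K = Nat.card F ^ 2 := by rw [Module.natCard_eq_pow_finrank (K := F), hFK]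
  simp only [Nat.card_prod, hK, hF, Nat.card_eq_fintype_card, Fintype.card_bool]
  ring

theorem le_exNum_combPasting {p n : ℕ} (hp : 8 ≤ p) (hn : 64 ≤ n) :
    (1 / 2 ^ 16 : ℝ) * (n : ℝ) ^ ((7 : ℝ) / 5) ≤ exNum n (combPasting p) := by
  have hex : ∃ j : ℕ, n < 64 * 1024 ^ j := ⟨n, by
    have := Nat.lt_pow_self (n := n) (a := 1024) (by norm_num)
    omega⟩
  classical
  obtain ⟨m, hm⟩ : ∃ m, Nat.find hex = m + 1 := Nat.exists_eq_succ_of_ne_zero (by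
    intro h
    have := Nat.find_spec hex
    rw [h] at this
    omega)
  have h1 : n < 64 * 1024 ^ (m + 1) := hm ▸ Nat.find_spec hex
  have h2 : 64 * 1024 ^ m ≤ n := not_lt.1 (Nat.find_min hex (by omega))
  have h3 := two_pow_le_exNum_combPasting (n := n) (k := 2 * m + 1) hp ⟨m, rfl⟩ (by
    refine le_trans (le_of_eq ?_) h2
    rw [← pow_mul, show (2 * m + 1) * 5 = 10 * m + 5 by ring, pow_add, pow_mul]
    norm_num
    ring)
  have h4 : (n : ℝ) ≤ ((2 : ℝ) ^ (2 * m + 3 + 1 / 5 : ℝ)) ^ (5 : ℝ) := by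
    rw [← Real.rpow_mul (by norm_num)]
    rw [show ((2 * m + 3 + 1 / 5 : ℝ) * 5) = ((10 * m + 16 : ℕ) : ℝ) by push_cast; ring,
      Real.rpow_natCast, pow_add, pow_mul]
    have : (n : ℝ) ≤ 64 * 1024 ^ (m + 1) := by exact_mod_cast h1.le
    refine this.trans (le_of_eq ?_)
    norm_num [pow_succ]
    ring
  have h5 : (n : ℝ) ^ ((7 : ℝ) / 5) ≤ 2 ^ 16 * ((2 : ℝ) ^ (2 * m + 1)) ^ 7 := by
    calc (n : ℝ) ^ ((7 : ℝ) / 5)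
        ≤ (((2 : ℝ) ^ (2 * m + 3 + 1 / 5 : ℝ)) ^ (5 : ℝ)) ^ ((7 : ℝ) / 5) := by gcongr
      _ = (2 : ℝ) ^ ((2 * m + 3 + 1 / 5 : ℝ) * 7) := by
          rw [← Real.rpow_mul (by positivity), ← Real.rpow_mul (by norm_num)]
          norm_num
      _ ≤ (2 : ℝ) ^ ((14 * m + 23 : ℕ) : ℝ) := by
          gcongr
          · norm_num
          · push_cast; linarith
      _ = 2 ^ 16 * ((2 : ℝ) ^ (2 * m + 1)) ^ 7 := by
          rw [Real.rpow_natCast, ← pow_mul, ← pow_add]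
          ring_nf
  have h6 : ((2 : ℝ) ^ (2 * m + 1)) ^ 7 ≤ exNum n (combPasting p) := by exact_mod_cast h3
  linarith

theorem exNum_combPasting_le {p n : ℕ} (hn : 1 ≤ n) :
    (exNum n (combPasting p) : ℝ) ≤
      8 * (((p * (9 * (3 * p + 3) ^ 2) : ℕ) : ℝ) ^ ((1 : ℝ) / 5) + 6 * p + 4) *
        (n : ℝ) ^ ((7 : ℝ) / 5) := by
  classical
  set Q : ℕ := p * (9 * (3 * p + 3) ^ 2) with hQ
  set r : ℝ := (Q : ℝ) ^ ((1 : ℝ) / 5) * (n : ℝ) ^ ((2 : ℝ) / 5) with hr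
  have hr0 : 0 ≤ r := by positivity
  have hr5 : r ^ 5 = Q * (n : ℝ) ^ 2 := by
    rw [hr, mul_pow, ← Real.rpow_natCast, ← Real.rpow_natCast, ← Real.rpow_mul (by positivity),
      ← Real.rpow_mul (by positivity)]
    norm_num
  let l : ℕ := ⌊r⌋₊ + 1 + (6 * p + 2)
  have hl : r < l := by
    have := Nat.lt_floor_add_one r
    push_cast [l]
    linarith [Nat.cast_nonneg (α := ℝ) p]
  have hle : exNum n (combPasting p) ≤ 8 * n * (l + 1) := by
    refine csSup_le' ?_
    rintro _ ⟨G, hG, rfl⟩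
    have h := G.card_edgeFinset_lt_of_not_contains_combPasting hG (l := l) (by omega) (by omega)
      (by simpa using Nat.pos_of_ne_zero (by omega)) (by
        rw [Fintype.card_fin, ← hQ]
        have : (Q : ℝ) * (n : ℝ) ^ 2 < (l : ℝ) ^ 5 := by
          rw [← hr5]
          gcongr
        exact_mod_cast this)
    rw [Fintype.card_fin] at h
    rw [← SimpleGraph.coe_edgeFinset, Set.ncard_coe_finset]
    exact h.le
  have hn1 : (1 : ℝ) ≤ n := by exact_mod_cast hn
  have hfl : (l : ℝ) + 1 ≤ r + (6 * p + 4) := by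
    have := Nat.floor_le hr0
    push_cast [l]
    linarith
  have h2 : (1 : ℝ) ≤ (n : ℝ) ^ ((2 : ℝ) / 5) := Real.one_le_rpow hn1 (by norm_num)
  have h7 : (n : ℝ) * (n : ℝ) ^ ((2 : ℝ) / 5) = (n : ℝ) ^ ((7 : ℝ) / 5) := by
    rw [← Real.rpow_one_add' (by positivity) (by norm_num)]
    norm_num
  calc (exNum n (combPasting p) : ℝ) ≤ 8 * n * (l + 1) := by exact_mod_cast hle
    _ ≤ 8 * n * (r + (6 * p + 4)) := by gcongr
    _ ≤ 8 * n * (r + (6 * p + 4) * (n : ℝ) ^ ((2 : ℝ) / 5)) := by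
        gcongr
        exact le_mul_of_one_le_right (by positivity) h2
    _ = _ := by
        rw [← h7, hr]
        ring

/-- There is $p_0$ such that for all $p ≥ p_0$, $ex(n, S_p) = Θ(n^{7/5})$. -/
theorem ex_combPasting_theta :
    ∃ p₀ : ℕ, 0 < p₀ ∧ ∀ p : ℕ, p₀ ≤ p →
      ∃ c₁ c₂ : ℝ, 0 < c₁ ∧ 0 < c₂ ∧
        ∀ᶠ n : ℕ in atTop,
          c₁ * (n : ℝ) ^ ((7 : ℝ) / 5) ≤ (exNum n (combPasting p) : ℝ) ∧
          (exNum n (combPasting p) : ℝ) ≤ c₂ * (n : ℝ) ^ ((7 : ℝ) / 5) := by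
  refine ⟨8, by norm_num, fun p hp => ⟨1 / 2 ^ 16,
    8 * (((p * (9 * (3 * p + 3) ^ 2) : ℕ) : ℝ) ^ ((1 : ℝ) / 5) + 6 * p + 4), by positivity,
    by positivity, ?_⟩⟩
  filter_upwards [eventually_ge_atTop 64] with n hn
  exact ⟨le_exNum_combPasting hp hn, exNum_combPasting_le (by omega)⟩
end

section
/- For all integers k, p ≥ 2 there exists a constant c = c(k, p) > 0 such that for all integers 2 ≤ m ≤ n: if k is odd then z(m, n, θ_{k,p}) ≤ c · ((mn)^{(k+1)/(2k)} + m + n), and if k is even then z(m, n, θ_{k,p}) ≤ c · (m^{(k+2)/(2k)} · n^{1/2} + m + n). -/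
open SimpleGraph Filter

/-- The theta graph `θ_{k,p}` (for `k ≥ 2`): `p` internally disjoint paths of length `k`
joining the two endpoints `Sum.inl false` and `Sum.inl true`; the internal vertices of the
`i`-th path are `(i, 0), …, (i, k-2)`. -/
def thetaGraph (k p : ℕ) : SimpleGraph (Bool ⊕ (Fin p × Fin (k - 1))) :=
  SimpleGraph.fromRel fun x y =>
    match x, y with
    | Sum.inl b, Sum.inr (_, j) => (b = false ∧ (j : ℕ) = 0) ∨ (b = true ∧ (j : ℕ) = k - 2)
    | Sum.inr (i, j), Sum.inr (ii, jj) => i = ii ∧ (jj : ℕ) = (j : ℕ) + 1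
    | _, _ => False

/-- The asymmetric bipartite Turán number `z(m, n, H)`: the maximum number of edges in a
bipartite graph with parts of sizes `m` and `n` containing no copy of `H`. -/
noncomputable def zNum {β : Type*} (m n : ℕ) (H : SimpleGraph β) : ℕ :=
  sSup {N : ℕ | ∃ G : SimpleGraph (Fin m ⊕ Fin n),
    G ≤ completeBipartiteGraph (Fin m) (Fin n) ∧ ¬ G.Contains H ∧ G.edgeSet.ncard = N}

/-- Internally disjoint paths of length `k` with common ends form a theta graph. -/
lemma contains_thetaGraph_of_paths {V : Type*} {G : SimpleGraph V} {k p : ℕ} (hk : 2 ≤ k)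
    (f : Fin p → ℕ → V) (y r : V) (h0 : ∀ i, f i 0 = y) (hr : ∀ i, f i k = r)
    (hadj : ∀ i j, j < k → G.Adj (f i j) (f i (j + 1))) (hyr : y ≠ r)
    (hfy : ∀ i j, 0 < j → j < k → f i j ≠ y) (hfr : ∀ i j, 0 < j → j < k → f i j ≠ r)
    (hinj : ∀ i j i' j', 0 < j → j < k → 0 < j' → j' < k → f i j = f i' j' → i = i' ∧ j = j') :
    G.Contains (thetaGraph k p) := by
  let φ : Bool ⊕ (Fin p × Fin (k - 1)) → V := fun x =>
    match x with
    | Sum.inl false => y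
    | Sum.inl true => r
    | Sum.inr (i, j) => f i (j + 1)
  refine ⟨⟨φ, ?_⟩, ?_⟩
  · have key : ∀ a b : Bool ⊕ (Fin p × Fin (k - 1)),
        (match a, b with
          | Sum.inl b, Sum.inr (_, j) => (b = false ∧ (j : ℕ) = 0) ∨ (b = true ∧ (j : ℕ) = k - 2)
          | Sum.inr (i, j), Sum.inr (ii, jj) => i = ii ∧ (jj : ℕ) = (j : ℕ) + 1
          | _, _ => False : Prop) → G.Adj (φ a) (φ b) := by
      rintro (b | ⟨i, j⟩) (b' | ⟨i', j'⟩) h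
      · exact h.elim
      · rcases h with ⟨rfl, hj⟩ | ⟨rfl, hj⟩
        · simpa [φ, hj, h0] using hadj i' 0 (by omega)
        · have := hadj i' (k - 1) (by omega)
          rw [show k - 1 + 1 = k by omega, hr] at this
          simpa [φ, hj, show k - 2 + 1 = k - 1 by omega] using this.symm
      · exact h.elim
      · obtain ⟨rfl, hj⟩ := h
        have := hadj i (j + 1) (by omega)
        simpa [φ, hj] using this
    intro a b hab
    rcases (SimpleGraph.fromRel_adj _ _ _).1 hab with ⟨-, h | h⟩
    · exact key a b h
    · exact (key b a h).symm
  · rintro (b | ⟨i, j⟩) (b' | ⟨i', j'⟩) h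
    · cases b <;> cases b' <;> simp_all [φ]
    · cases b
      · exact absurd h.symm (hfy _ _ (by omega) (by omega))
      · exact absurd h.symm (hfr _ _ (by omega) (by omega))
    · cases b'
      · exact absurd h (hfy _ _ (by omega) (by omega))
      · exact absurd h (hfr _ _ (by omega) (by omega))
    · obtain ⟨rfl, h2⟩ := hinj i (j + 1) i' (j' + 1) (by omega) (by omega) (by omega) (by omega) h
      have : j = j' := Fin.ext (by omega)
      rw [this]

/-- A bipartite edge set with more edges than the total prescribed degree contains a nonempty
subset in which every vertex exceeds its prescribed degree. -/
lemma exists_subset_degree_lt {α β : Type*} [DecidableEq α] [DecidableEq β]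
    (f : α → ℕ) (g : β → ℕ) (E : Finset (α × β)) :
    ∀ (A : Finset α) (B : Finset β), (∀ e ∈ E, e.1 ∈ A ∧ e.2 ∈ B) →
      ∑ a ∈ A, f a + ∑ b ∈ B, g b < E.card →
      ∃ E' ⊆ E, E'.Nonempty ∧ (∀ e ∈ E', f e.1 < (E'.filter fun e' => e'.1 = e.1).card) ∧
        ∀ e ∈ E', g e.2 < (E'.filter fun e' => e'.2 = e.2).card := by
  induction E using Finset.strongInduction with
  | H E ih =>
    intro A B hE hcard
    by_cases h1 : ∀ e ∈ E, f e.1 < (E.filter fun e' => e'.1 = e.1).card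
    · by_cases h2 : ∀ e ∈ E, g e.2 < (E.filter fun e' => e'.2 = e.2).card
      · exact ⟨E, subset_rfl, Finset.card_pos.1 (by omega), h1, h2⟩
      · push Not at h2
        obtain ⟨e, he, hle⟩ := h2
        obtain ⟨E', hE', h⟩ := ih (E.filter fun e' => ¬ e'.2 = e.2)
          (Finset.filter_ssubset.2 ⟨e, he, by simp⟩) A (B.erase e.2)
          (fun e' he' => by
            rw [Finset.mem_filter] at he'
            exact ⟨(hE _ he'.1).1, Finset.mem_erase.2 ⟨he'.2, (hE _ he'.1).2⟩⟩)
          (by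
            have := Finset.card_filter_add_card_filter_not (s := E) fun e' => e'.2 = e.2
            have := Finset.add_sum_erase B g (hE e he).2
            omega)
        exact ⟨E', hE'.trans (Finset.filter_subset _ _), h⟩
    · push Not at h1
      obtain ⟨e, he, hle⟩ := h1
      obtain ⟨E', hE', h⟩ := ih (E.filter fun e' => ¬ e'.1 = e.1)
        (Finset.filter_ssubset.2 ⟨e, he, by simp⟩) (A.erase e.1) B
        (fun e' he' => by
          rw [Finset.mem_filter] at he'
          exact ⟨Finset.mem_erase.2 ⟨he'.2, (hE _ he'.1).1⟩, (hE _ he'.1).2⟩)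
        (by
          have := Finset.card_filter_add_card_filter_not (s := E) fun e' => e'.1 = e.1
          have := Finset.add_sum_erase A f (hE e he).1
          omega)
      exact ⟨E', hE'.trans (Finset.filter_subset _ _), h⟩

open Classical in
/-- Greedy construction of a path of length `L` whose `j`-th step goes to a vertex of `N j`
with a value of `κ j` not taken on `F` or on the earlier vertices. -/
lemma exists_path_avoiding {V : Type*} (κ : ℕ → V → V) (N : ℕ → V → Finset V)
    (P : ℕ → V → Prop) (q : ℕ) (y : V) (hy : P 0 y) (F : Finset V) (L : ℕ)
    (hN : ∀ j < L, ∀ v, P j v → q ≤ ((N j v).image (κ j)).card ∧ ∀ u ∈ N j v, P (j + 1) u)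
    (hF : F.card + L < q) :
    ∃ g : ℕ → V, g 0 = y ∧ (∀ j < L, g (j + 1) ∈ N j (g j)) ∧ (∀ j ≤ L, P j (g j)) ∧
      (∀ j < L, ∀ u ∈ F, κ j (g (j + 1)) ≠ κ j u) ∧
      ∀ j < L, ∀ j' ≤ j, κ j (g (j + 1)) ≠ κ j (g j') := by
  induction L with
  | zero => exact ⟨fun _ => y, by simp [hy]⟩
  | succ L ih =>
    obtain ⟨g, g0, gN, gP, gF, gI⟩ := ih (fun j hj => hN j (by omega)) (by omega)
    obtain ⟨hq, hP⟩ := hN L (by omega) (g L) (gP L le_rfl)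
    have hlt : ((F ∪ (Finset.range (L + 1)).image g).image (κ L)).card <
        ((N L (g L)).image (κ L)).card := by
      have h1 := Finset.card_image_le (s := F ∪ (Finset.range (L + 1)).image g) (f := κ L)
      have h2 := Finset.card_union_le F ((Finset.range (L + 1)).image g)
      have h3 := Finset.card_image_le (s := Finset.range (L + 1)) (f := g)
      rw [Finset.card_range] at h3
      omega
    obtain ⟨z, hz, hz'⟩ := Finset.exists_mem_notMem_of_card_lt_card hlt
    obtain ⟨u, hu, rfl⟩ := Finset.mem_image.1 hz
    have hav : ∀ v ∈ F ∪ (Finset.range (L + 1)).image g, κ L u ≠ κ L v := fun v hv h =>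
      hz' (Finset.mem_image.2 ⟨v, hv, h.symm⟩)
    have hlow : ∀ j ≤ L, Function.update g (L + 1) u j = g j := fun j hj =>
      Function.update_of_ne (by omega) _ _
    have htop : Function.update g (L + 1) u (L + 1) = u := Function.update_self _ _ _
    refine ⟨Function.update g (L + 1) u, by rw [hlow 0 (by omega), g0], ?_, ?_, ?_, ?_⟩
    · intro j hj
      rcases Nat.lt_succ_iff_lt_or_eq.1 hj with h | rfl
      · rw [hlow j h.le, hlow (j + 1) h]; exact gN j h
      · rw [hlow j le_rfl, htop]; exact hu
    · intro j hj
      rcases Nat.le_succ_iff.1 hj with h | rfl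
      · rw [hlow j h]; exact gP j h
      · rw [htop]; exact hP u hu
    · intro j hj v hv
      rcases Nat.lt_succ_iff_lt_or_eq.1 hj with h | rfl
      · rw [hlow (j + 1) h]; exact gF j h v hv
      · rw [htop]; exact hav v (Finset.mem_union_left _ hv)
    · intro j hj j' hj'
      rcases Nat.lt_succ_iff_lt_or_eq.1 hj with h | rfl
      · rw [hlow (j + 1) h, hlow j' (by omega)]; exact gI j h j' hj'
      · rw [htop, hlow j' hj']
        exact hav _ (Finset.mem_union_right _
          (Finset.mem_image.2 ⟨j', Finset.mem_range.2 (by omega), rfl⟩))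

open Classical in
/-- Greedy construction of `n` paths of length `L` from `y` that are disjoint apart from `y`. -/
lemma exists_spider {V : Type*} (κ : ℕ → V → V) (N : ℕ → V → Finset V)
    (P : ℕ → V → Prop) (q : ℕ) (y : V) (hy : P 0 y) (L : ℕ)
    (hN : ∀ j < L, ∀ v, P j v → q ≤ ((N j v).image (κ j)).card ∧ ∀ u ∈ N j v, P (j + 1) u)
    (n : ℕ) (hn : n * (L + 1) ≤ q) :
    ∃ g : ℕ → ℕ → V, ∀ i < n, g i 0 = y ∧ (∀ j < L, g i (j + 1) ∈ N j (g i j)) ∧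
      (∀ j ≤ L, P j (g i j)) ∧
      (∀ j < L, ∀ i' < i, ∀ j' ≤ L, κ j (g i (j + 1)) ≠ κ j (g i' j')) ∧
      ∀ j < L, ∀ j' ≤ j, κ j (g i (j + 1)) ≠ κ j (g i j') := by
  induction n with
  | zero => exact ⟨fun _ _ => y, by simp⟩
  | succ n ih =>
    rw [Nat.succ_mul] at hn
    obtain ⟨g, hg⟩ := ih (by omega)
    obtain ⟨l, l0, lN, lP, lF, lI⟩ := exists_path_avoiding κ N P q y hy
      ((Finset.range n ×ˢ Finset.range (L + 1)).image fun x => g x.1 x.2) L hN (by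
        have := Finset.card_image_le (s := Finset.range n ×ˢ Finset.range (L + 1))
          (f := fun x => g x.1 x.2)
        rw [Finset.card_product, Finset.card_range, Finset.card_range] at this
        omega)
    have hlow : ∀ i < n, Function.update g n l i = g i := fun i hi =>
      Function.update_of_ne (by omega) _ _
    have htop : Function.update g n l n = l := Function.update_self _ _ _
    refine ⟨Function.update g n l, fun i hi => ?_⟩
    rcases Nat.lt_succ_iff_lt_or_eq.1 hi with h | rfl
    · obtain ⟨h1, h2, h3, h4, h5⟩ := hg i h
      rw [hlow i h]
      refine ⟨h1, h2, h3, fun j hj i' hi' j' hj' => ?_, h5⟩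
      rw [hlow i' (by omega)]
      exact h4 j hj i' hi' j' hj'
    · rw [htop]
      refine ⟨l0, lN, lP, fun j hj i' hi' j' hj' => ?_, lI⟩
      rw [hlow i' hi']
      exact lF j hj _ (Finset.mem_image.2 ⟨(i', j'), Finset.mem_product.2
        ⟨Finset.mem_range.2 hi', Finset.mem_range.2 (by omega)⟩, rfl⟩)

lemma iterate_parent_level {V : Type*} {lev : V → ℕ} {par : V → V}
    (hpar : ∀ v, 0 < lev v → lev (par v) + 1 = lev v) (a : ℕ) (v : V) (ha : a ≤ lev v) :
    lev (par^[a] v) + a = lev v := by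
  induction a with
  | zero => simp
  | succ a ih =>
    have h1 := ih (by omega)
    have h2 := hpar (par^[a] v) (by omega)
    rw [Function.iterate_succ_apply']
    omega

open Classical in
/-- If every upper vertex of the edge set `E` sees at least `q` branches of the tree below, then
a subset `D` of `E` with large minimum degree produces a theta graph: a spider inside `D`, whose
feet lie in different branches, is completed by the tree paths to the root `r`. -/
lemma contains_thetaGraph_of_many_branches {V : Type*} {G : SimpleGraph V} {k p q h i₀ : ℕ}
    (hh : 1 ≤ h) (hhk : h < k) (hhi : h ≤ i₀) (hq : p * (k + 1) ≤ q)
    {lev : V → ℕ} {par : V → V}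
    (hpar : ∀ v, 0 < lev v → G.Adj v (par v) ∧ lev (par v) + 1 = lev v) (r : V)
    (E D : Finset (V × V))
    (hE : ∀ e ∈ E, lev e.1 = i₀ ∧ par^[h] e.1 = r ∧ lev e.2 = i₀ + 1 ∧ G.Adj e.1 e.2)
    (hEq : ∀ e ∈ E, q ≤ ((E.filter fun e' => e'.2 = e.2).image fun e' => par^[h - 1] e'.1).card)
    (hDE : D ⊆ E) (hD : D.Nonempty)
    (hD1 : ∀ e ∈ D, q < (D.filter fun e' => e'.1 = e.1).card)
    (hD2 : ∀ e ∈ D, q < (D.filter fun e' => e'.2 = e.2).card) :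
    G.Contains (thetaGraph k p) := by
  obtain ⟨l, rfl⟩ : ∃ l, k = l + 1 + h := ⟨k - h - 1, by omega⟩
  let κ : ℕ → V → V := fun j => if j < l then id else par^[h - 1]
  let N : ℕ → V → Finset V := fun j v =>
    if Even (l + j) then ((if j < l then D else E).filter fun e => e.2 = v).image Prod.fst
    else (D.filter fun e => e.1 = v).image Prod.snd
  let P : ℕ → V → Prop := fun j v =>
    if Even (l + j) then ∃ e ∈ D, e.2 = v else ∃ e ∈ E, e.1 = v ∧ (j ≤ l → e ∈ D)
  have hN : ∀ j < l + 1, ∀ v, P j v →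
      q ≤ ((N j v).image (κ j)).card ∧ ∀ u ∈ N j v, P (j + 1) u := by
    intro j hj v hv
    by_cases hev : Even (l + j)
    · have hev' : ¬ Even (l + (j + 1)) := by rw [← add_assoc, Nat.even_add_one]; simpa using hev
      simp only [P, if_pos hev] at hv
      obtain ⟨e, he, rfl⟩ := hv
      by_cases hjl : j < l
      · simp only [N, P, κ, if_pos hev, if_neg hev', if_pos hjl, Finset.image_id]
        refine ⟨?_, ?_⟩
        · rw [Finset.card_image_of_injOn]
          · exact (hD2 e he).le
          · intro a ha b hb hab
            simp only [Finset.coe_filter, Set.mem_ofPred_eq] at ha hb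
            exact Prod.ext hab (ha.2.trans hb.2.symm)
        · intro u hu
          obtain ⟨e', he', rfl⟩ := Finset.mem_image.1 hu
          rw [Finset.mem_filter] at he'
          exact ⟨e', hDE he'.1, rfl, fun _ => he'.1⟩
      · simp only [N, P, κ, if_pos hev, if_neg hev', if_neg hjl, Finset.image_image]
        refine ⟨hEq e (hDE he), ?_⟩
        intro u hu
        obtain ⟨e', he', rfl⟩ := Finset.mem_image.1 hu
        rw [Finset.mem_filter] at he'
        exact ⟨e', he'.1, rfl, fun h => by omega⟩
    · have hev' : Even (l + (j + 1)) := by rw [← add_assoc, Nat.even_add_one]; exact hev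
      have hjl : j < l := by
        rcases Nat.lt_succ_iff_lt_or_eq.1 hj with h | rfl
        · exact h
        · exact absurd ⟨_, rfl⟩ hev
      simp only [P, if_neg hev] at hv
      obtain ⟨e, -, rfl, he⟩ := hv
      replace he := he hjl.le
      simp only [N, P, κ, if_neg hev, if_pos hev', if_pos hjl, Finset.image_id]
      refine ⟨?_, ?_⟩
      · rw [Finset.card_image_of_injOn]
        · exact (hD1 e he).le
        · intro a ha b hb hab
          simp only [Finset.coe_filter, Set.mem_ofPred_eq] at ha hb
          exact Prod.ext (ha.2.trans hb.2.symm) hab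
      · intro u hu
        obtain ⟨e', he', rfl⟩ := Finset.mem_image.1 hu
        rw [Finset.mem_filter] at he'
        exact ⟨e', he'.1, rfl⟩
  obtain ⟨y, hy⟩ : ∃ y, P 0 y := by
    obtain ⟨e, he⟩ := hD
    by_cases hev : Even (l + 0)
    · exact ⟨e.2, by simp only [P, if_pos hev]; exact ⟨e, he, rfl⟩⟩
    · exact ⟨e.1, by simp only [P, if_neg hev]; exact ⟨e, hDE he, rfl, fun _ => he⟩⟩
  have hPlev : ∀ j v, P j v → i₀ ≤ lev v := by
    intro j v hv
    by_cases hev : Even (l + j)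
    · simp only [P, if_pos hev] at hv
      obtain ⟨e, he, rfl⟩ := hv
      have := (hE e (hDE he)).2.2.1
      omega
    · simp only [P, if_neg hev] at hv
      obtain ⟨e, he, rfl, -⟩ := hv
      exact (hE e he).1.ge
  have hNadj : ∀ j v, ∀ u ∈ N j v, G.Adj v u := by
    intro j v u hu
    by_cases hev : Even (l + j)
    · simp only [N, if_pos hev] at hu
      obtain ⟨e, he, rfl⟩ := Finset.mem_image.1 hu
      rw [Finset.mem_filter] at he
      have heE : e ∈ E := by
        have := he.1
        split_ifs at this
        · exact hDE this
        · exact this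
      rw [← he.2]
      exact (hE e heE).2.2.2.symm
    · simp only [N, if_neg hev] at hu
      obtain ⟨e, he, rfl⟩ := Finset.mem_image.1 hu
      rw [Finset.mem_filter] at he
      rw [← he.2]
      exact (hE e (hDE he.1)).2.2.2
  obtain ⟨g, hg⟩ := exists_spider κ N P q y hy (l + 1) hN p
    (le_trans (Nat.mul_le_mul_left _ (by omega)) hq)
  have hfoot : ∀ i < p, lev (g i (l + 1)) = i₀ ∧ par^[h] (g i (l + 1)) = r := by
    intro i hi
    have := (hg i hi).2.2.1 (l + 1) le_rfl
    have hev : ¬ Even (l + (l + 1)) := by rw [← add_assoc, Nat.even_add_one]; simp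
    simp only [P, if_neg hev] at this
    obtain ⟨e, he, h1, -⟩ := this
    rw [← h1]
    exact ⟨(hE e he).1, (hE e he).2.1⟩
  have hdisj : ∀ i < p, ∀ i' ≤ i, ∀ j ≤ l + 1, ∀ j' ≤ l + 1, 0 < j → (i' = i → j' < j) →
      g i j ≠ g i' j' := by
    intro i hi i' hi' j hj j' hj' hj0 hlt heq
    obtain ⟨j, rfl⟩ : ∃ a, j = a + 1 := ⟨j - 1, by omega⟩
    rcases hi'.lt_or_eq with h | h
    · exact (hg i hi).2.2.2.1 j hj i' h j' hj' (congrArg _ heq)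
    · rw [h] at heq
      exact (hg i hi).2.2.2.2 j hj j' (by have := hlt h; omega) (congrArg _ heq)
  have hbranch : ∀ i < p, ∀ i' < i, par^[h - 1] (g i (l + 1)) ≠ par^[h - 1] (g i' (l + 1)) := by
    intro i hi i' hi'
    simpa [κ] using (hg i hi).2.2.2.1 l (by omega) i' hi' (l + 1) le_rfl
  have hlev : ∀ i < p, ∀ a ≤ h, lev (par^[a] (g i (l + 1))) + a = i₀ := by
    intro i hi a ha
    rw [iterate_parent_level (fun v hv => (hpar v hv).2) a _ (by rw [(hfoot i hi).1]; omega),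
      (hfoot i hi).1]
  have hlevg : ∀ i < p, ∀ j ≤ l + 1, i₀ ≤ lev (g i j) := fun i hi j hj =>
    hPlev j _ ((hg i hi).2.2.1 j hj)
  let f : Fin p → ℕ → V := fun i j => par^[j - (l + 1)] (g i (min j (l + 1)))
  have hflow : ∀ i j, j ≤ l + 1 → f i j = g i j := by
    intro i j hj
    simp [f, min_eq_left hj, Nat.sub_eq_zero_of_le hj]
  have hfhigh : ∀ i j, l + 1 ≤ j → f i j = par^[j - (l + 1)] (g i (l + 1)) := by
    intro i j hj
    simp [f, min_eq_right hj]
  have hflev : ∀ i j, l + 1 < j → j ≤ l + 1 + h → lev (f i j) + (j - (l + 1)) = i₀ := by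
    intro i j hj hj'
    rw [hfhigh i j hj.le]
    exact hlev i i.2 _ (by omega)
  have hfr : ∀ i : Fin p, f i (l + 1 + h) = r := by
    intro i
    rw [hfhigh i _ (by omega), Nat.add_sub_cancel_left]
    exact (hfoot i i.2).2
  have hylev : i₀ ≤ lev y := hPlev 0 y hy
  by_cases hp : p = 0
  · subst hp
    refine contains_thetaGraph_of_paths (by omega) f y (par^[h] y) (fun i => i.elim0)
      (fun i => i.elim0) (fun i => i.elim0) ?_ (fun i => i.elim0) (fun i => i.elim0)
      (fun i => i.elim0)
    intro heq
    have := iterate_parent_level (fun v hv => (hpar v hv).2) h y (by omega)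
    rw [← heq] at this
    omega
  have hrlev : lev r + h = i₀ := by
    have := hlev 0 (by omega) h le_rfl
    rwa [(hfoot 0 (by omega)).2] at this
  refine contains_thetaGraph_of_paths (by omega) f y r ?_ hfr ?_ ?_ ?_ ?_ ?_
  · intro i
    rw [hflow i 0 (by omega)]
    exact (hg i i.2).1
  · intro i j hj
    rcases lt_or_ge j (l + 1) with hjl | hjl
    · rw [hflow i j hjl.le, hflow i (j + 1) hjl]
      exact hNadj j _ _ ((hg i i.2).2.1 j hjl)
    · rw [hfhigh i j hjl, hfhigh i (j + 1) (by omega), Nat.succ_sub hjl,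
        Function.iterate_succ_apply']
      refine (hpar _ ?_).1
      have := hlev i i.2 (j - (l + 1)) (by omega)
      omega
  · rintro rfl
    omega
  · intro i j hj hjk
    rcases le_or_gt j (l + 1) with hjl | hjl
    · rw [hflow i j hjl, ← (hg i i.2).1]
      exact hdisj i i.2 i le_rfl j hjl 0 (by omega) hj fun _ => hj
    · intro heq
      have := hflev i j hjl hjk.le
      rw [heq] at this
      omega
  · intro i j hj hjk heq
    rcases le_or_gt j (l + 1) with hjl | hjl
    · rw [hflow i j hjl] at heq
      have := hlevg i i.2 j hjl
      rw [heq] at this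
      omega
    · have := hflev i j hjl hjk.le
      rw [heq] at this
      omega
  · have key : ∀ i j i' j', 0 < j → j < l + 1 + h → 0 < j' → j' < l + 1 + h → f i j = f i' j' →
        i' ≤ i → i = i' ∧ j = j' := by
      intro i j i' j' hj hjk hj' hjk' heq hii
      rcases le_or_gt j (l + 1) with hjl | hjl <;> rcases le_or_gt j' (l + 1) with hjl' | hjl'
      · rw [hflow i j hjl, hflow i' j' hjl'] at heq
        rcases hii.lt_or_eq with h | rfl
        · exact absurd heq (hdisj i i.2 i' h.le j hjl j' hjl' hj fun h' => by
            have : (i' : ℕ) < i := h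
            omega)
        · rcases lt_trichotomy j j' with h | h | h
          · exact absurd heq.symm (hdisj i' i'.2 i' le_rfl j' hjl' j hjl hj' fun _ => h)
          · exact ⟨rfl, h⟩
          · exact absurd heq (hdisj i' i'.2 i' le_rfl j hjl j' hjl' hj fun _ => h)
      · have h1 := hflev i' j' hjl' hjk'.le
        rw [← heq, hflow i j hjl] at h1
        have := hlevg i i.2 j hjl
        omega
      · have h1 := hflev i j hjl hjk.le
        rw [heq, hflow i' j' hjl'] at h1
        have := hlevg i' i'.2 j' hjl'
        omega
      · have h1 := hflev i j hjl hjk.le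
        have h2 := hflev i' j' hjl' hjk'.le
        rw [heq] at h1
        obtain rfl : j = j' := by omega
        refine ⟨?_, rfl⟩
        rcases hii.lt_or_eq with hlt | heq'
        · refine absurd ?_ (hbranch i i.2 i' hlt)
          rw [hfhigh i j hjl.le, hfhigh i' j hjl.le] at heq
          have := congrArg (par^[h - 1 - (j - (l + 1))]) heq
          rwa [← Function.iterate_add_apply, ← Function.iterate_add_apply,
            Nat.sub_add_cancel (by omega)] at this
        · exact heq'.symm
    intro i j i' j' hj hjk hj' hjk' heq
    rcases le_total i' i with hii | hii
    · exact key i j i' j' hj hjk hj' hjk' heq hii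
    · obtain ⟨h1, h2⟩ := key i' j' i j hj' hjk' hj hjk heq.symm hii
      exact ⟨h1.symm, h2.symm⟩

open Classical in
/-- A dense edge set between the leaves `S` of a tree of height `h` rooted at `r` and a set `W`
above them produces a theta graph. -/
lemma contains_thetaGraph_of_dense {V : Type*} {G : SimpleGraph V} {k p q i₀ : ℕ}
    (hq : p * (k + 1) ≤ q) (hq0 : 0 < q) {lev : V → ℕ} {par : V → V}
    (hpar : ∀ v, 0 < lev v → G.Adj v (par v) ∧ lev (par v) + 1 = lev v) (h : ℕ)
    (hhk : h < k) (hhi : h ≤ i₀) :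
    ∀ (S W : Finset V) (E : Finset (V × V)) (r : V), (∀ s ∈ S, lev s = i₀ ∧ par^[h] s = r) →
      (∀ w ∈ W, lev w = i₀ + 1) → (∀ e ∈ E, e.1 ∈ S ∧ e.2 ∈ W ∧ G.Adj e.1 e.2) →
      q * (2 * q) ^ h * (S.card + W.card) < E.card → G.Contains (thetaGraph k p) := by
  induction h with
  | zero =>
    intro S W E r hS hW hE hcard
    have h1 : E.card ≤ W.card := by
      refine Finset.card_le_card_of_injOn Prod.snd (fun e he => (hE e he).2.1) ?_
      intro a ha b hb hab
      exact Prod.ext ((hS _ (hE a ha).1).2.trans (hS _ (hE b hb).1).2.symm) hab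
    have h2 : 1 * (S.card + W.card) ≤ q * (2 * q) ^ 0 * (S.card + W.card) :=
      Nat.mul_le_mul_right _ (by simpa using Nat.succ_le_of_lt hq0)
    omega
  | succ h ih =>
    intro S W E r hS hW hE hcard
    let β : V → V := par^[h]
    let br : V → Finset V := fun w => (E.filter fun e => e.2 = w).image fun e => β e.1
    let E₁ := E.filter fun e => ¬ q ≤ (br e.2).card
    let E₂ := E.filter fun e => q ≤ (br e.2).card
    have hsplit : E₂.card + E₁.card = E.card :=
      Finset.card_filter_add_card_filter_not fun e : V × V => q ≤ (br e.2).card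
    rcases le_total E₁.card E₂.card with hle | hle
    · have hdense : ∑ _s ∈ S, q + ∑ _w ∈ W, q < E₂.card := by
        have h1 : 1 ≤ (2 * q) ^ h := Nat.one_le_pow _ _ (by omega)
        have h2 : 2 * (q * (S.card + W.card)) ≤ q * (2 * q) ^ (h + 1) * (S.card + W.card) := by
          calc 2 * (q * (S.card + W.card)) = 1 * (2 * 1) * (q * (S.card + W.card)) := by ring
            _ ≤ (2 * q) ^ h * (2 * q) * (q * (S.card + W.card)) := by gcongr; omega
            _ = _ := by ring
        simp only [Finset.sum_const, smul_eq_mul]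
        have h3 : S.card * q + W.card * q = q * (S.card + W.card) := by ring
        omega
      have hE₂E : E₂ ⊆ E := Finset.filter_subset _ _
      obtain ⟨D, hDE, hD, hD1, hD2⟩ := exists_subset_degree_lt (fun _ => q) (fun _ => q) E₂ S W
        (fun e he => ⟨(hE e (hE₂E he)).1, (hE e (hE₂E he)).2.1⟩) hdense
      refine contains_thetaGraph_of_many_branches (h := h + 1) (by omega) hhk hhi hq hpar r E₂ D
        (fun e he => ?_) (fun e he => ?_) hDE hD hD1 hD2
      · obtain ⟨h1, h2, h3⟩ := hE e (hE₂E he)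
        exact ⟨(hS _ h1).1, (hS _ h1).2, hW _ h2, h3⟩
      · have he' := (Finset.mem_filter.1 he).2
        refine he'.trans (Finset.card_le_card (Finset.image_subset_image fun e' h' => ?_))
        rw [Finset.mem_filter] at h' ⊢
        exact ⟨Finset.mem_filter.2 ⟨h'.1, by rw [h'.2]; exact he'⟩, h'.2⟩
    · have hmax : ∀ w, ∃ b, (E₁.filter fun e => e.2 = w).card ≤
          q * ((E₁.filter fun e => e.2 = w).filter fun e => β e.1 = b).card := by
        intro w
        rcases (E₁.filter fun e => e.2 = w).eq_empty_or_nonempty with hem | hne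
        · exact ⟨w, by simp [hem]⟩
        · obtain ⟨b, -, hb⟩ := Finset.exists_max_image
            ((E₁.filter fun e => e.2 = w).image fun e => β e.1)
            (fun b => ((E₁.filter fun e => e.2 = w).filter fun e => β e.1 = b).card)
            (hne.image _)
          refine ⟨b, (Finset.card_le_mul_card_image _ _ hb).trans ?_⟩
          rw [mul_comm]
          refine Nat.mul_le_mul_right _ ?_
          obtain ⟨e, he⟩ := hne
          obtain ⟨heE, rfl⟩ := Finset.mem_filter.1 he
          have hlt := (Finset.mem_filter.1 heE).2
          refine le_trans (Finset.card_le_card (Finset.image_subset_image ?_)) (not_le.1 hlt).le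
          exact Finset.filter_subset_filter _ (Finset.filter_subset _ _)
      choose j hj using hmax
      let E' := E₁.filter fun e => β e.1 = j e.2
      have hE'E : E' ⊆ E := (Finset.filter_subset _ _).trans (Finset.filter_subset _ _)
      have hE₁E' : E₁.card ≤ q * E'.card := by
        rw [Finset.card_eq_sum_card_fiberwise (f := Prod.snd) (s := E₁) (t := W)
          (fun e he => (hE e (Finset.filter_subset _ _ he)).2.1),
          Finset.card_eq_sum_card_fiberwise (f := Prod.snd) (s := E') (t := W)
          (fun e he => (hE e (hE'E he)).2.1), Finset.mul_sum]
        refine Finset.sum_le_sum fun w _ => (hj w).trans (Nat.mul_le_mul_left _ ?_)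
        refine Finset.card_le_card fun e he => ?_
        simp only [E', Finset.mem_filter] at he ⊢
        obtain ⟨⟨h1, rfl⟩, h2⟩ := he
        exact ⟨⟨h1, h2⟩, rfl⟩
      have hdense : q * (2 * q) ^ h * (S.card + W.card) < E'.card := by
        have h1 : q * (2 * q) ^ (h + 1) * (S.card + W.card) =
          (2 * q) * (q * (2 * q) ^ h * (S.card + W.card)) := by ring
        have h2 : 2 * (q * E'.card) = 2 * q * E'.card := by ring
        exact Nat.lt_of_mul_lt_mul_left (a := 2 * q) (by omega)
      let B := S.image β ∪ W.image j
      rw [Finset.card_eq_sum_card_fiberwise (f := fun e => β e.1) (s := E') (t := B)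
          (fun e he => Finset.mem_union_left _
            (Finset.mem_image_of_mem _ (hE e (hE'E he)).1)),
        Finset.card_eq_sum_card_fiberwise (f := β) (s := S) (t := B)
          (fun s hs => Finset.mem_union_left _ (Finset.mem_image_of_mem _ hs)),
        Finset.card_eq_sum_card_fiberwise (f := j) (s := W) (t := B)
          (fun s hs => Finset.mem_union_right _ (Finset.mem_image_of_mem _ hs)),
        ← Finset.sum_add_distrib, Finset.mul_sum] at hdense
      obtain ⟨b, -, hb⟩ := Finset.exists_lt_of_sum_lt hdense
      refine ih (by omega) (by omega) _ _ _ b (fun s hs => ?_) (fun w hw => ?_)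
        (fun e he => ?_) hb
      · obtain ⟨h1, h2⟩ := Finset.mem_filter.1 hs
        exact ⟨(hS s h1).1, h2⟩
      · exact hW w (Finset.mem_filter.1 hw).1
      · obtain ⟨h1, h2⟩ := Finset.mem_filter.1 he
        obtain ⟨h3, h4, h5⟩ := hE e (hE'E h1)
        have h6 := (Finset.mem_filter.1 h1).2
        exact ⟨Finset.mem_filter.2 ⟨h3, h2⟩, Finset.mem_filter.2 ⟨h4, h6.symm.trans h2⟩, h5⟩

lemma exists_adj_dist_add_one {V : Type*} {G : SimpleGraph V} {x v : V} (hv : 0 < G.dist x v) :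
    ∃ u, G.Adj v u ∧ G.dist x u + 1 = G.dist x v := by
  have hr : G.Reachable v x := (Reachable.of_dist_ne_zero hv.ne').symm
  obtain ⟨w, hw⟩ := hr.exists_walk_length_eq_dist
  rw [dist_comm] at hw
  cases w with
  | nil => simp at hv
  | @cons _ u _ huv w =>
    refine ⟨u, huv, ?_⟩
    have h1 := dist_le w
    rw [dist_comm] at h1
    rw [Walk.length_cons] at hw
    have h2 := huv.diff_dist_adj (u := x)
    omega

open Classical in
/-- The vertices at distance `i` from `x`. -/
noncomputable def distLevel {V : Type*} [Fintype V] (G : SimpleGraph V) (x : V) (i : ℕ) :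
    Finset V :=
  Finset.univ.filter fun v => G.Reachable x v ∧ G.dist x v = i

lemma mem_distLevel {V : Type*} [Fintype V] {G : SimpleGraph V} {x v : V} {i : ℕ} :
    v ∈ distLevel G x i ↔ G.Reachable x v ∧ G.dist x v = i := by
  simp [distLevel]

lemma coloring_of_mem_distLevel {V : Type*} [Fintype V] {G : SimpleGraph V}
    (c : G.Coloring Bool) {x v : V} {i : ℕ} (hv : v ∈ distLevel G x i) :
    Even i ↔ c x = c v := by
  obtain ⟨hr, rfl⟩ := mem_distLevel.1 hv
  obtain ⟨w, hw⟩ := hr.exists_walk_length_eq_dist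
  rw [← hw, c.even_length_iff_congr w]
  exact Bool.eq_iff_iff.symm

lemma mem_distLevel_of_adj {V : Type*} [Fintype V] {G : SimpleGraph V} (c : G.Coloring Bool)
    {x v u : V} {i : ℕ} (hv : v ∈ distLevel G x i) (h : G.Adj v u) :
    u ∈ distLevel G x (i + 1) ∨ 0 < i ∧ u ∈ distLevel G x (i - 1) := by
  obtain ⟨hr, hi⟩ := mem_distLevel.1 hv
  have hru : G.Reachable x u := hr.trans h.reachable
  have hu : u ∈ distLevel G x (G.dist x u) := mem_distLevel.2 ⟨hru, rfl⟩
  have hne : G.dist x u ≠ i := by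
    intro heq
    rw [heq] at hu
    have h1 := coloring_of_mem_distLevel c hv
    have h2 := coloring_of_mem_distLevel c hu
    have h3 := c.valid h
    revert h1 h2 h3
    generalize c x = a
    generalize c v = b
    generalize c u = d
    cases a <;> cases b <;> cases d <;> simp_all
  rcases h.diff_dist_adj (u := x) with h1 | h1 | h1
  · omega
  · left
    rwa [h1, hi] at hu
  · right
    rw [hi] at h1
    refine ⟨by omega, ?_⟩
    rwa [h1] at hu

open Classical in
/-- In a graph without theta graphs, consecutive distance levels span few edges. -/
lemma sum_card_adj_distLevel_le {V : Type*} [Fintype V] {G : SimpleGraph V} {k p q : ℕ}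
    (hq : p * (k + 1) ≤ q) (hq0 : 0 < q) (hfree : ¬ G.Contains (thetaGraph k p)) (x : V) (i : ℕ)
    (hi : i < k) :
    ∑ v ∈ distLevel G x i, ((distLevel G x (i + 1)).filter (G.Adj v)).card ≤
      q * (2 * q) ^ k * ((distLevel G x i).card + (distLevel G x (i + 1)).card) := by
  have hex : ∀ v, ∃ u, 0 < G.dist x v → G.Adj v u ∧ G.dist x u + 1 = G.dist x v := by
    intro v
    by_cases hv : 0 < G.dist x v
    · obtain ⟨u, hu⟩ := exists_adj_dist_add_one hv
      exact ⟨u, fun _ => hu⟩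
    · exact ⟨v, fun h => absurd h hv⟩
  choose par hpar using hex
  have hreach : ∀ a v, G.Reachable x v → a ≤ G.dist x v → G.Reachable x (par^[a] v) := by
    intro a v hv ha
    induction a with
    | zero => exact hv
    | succ a ih =>
      rw [Function.iterate_succ_apply']
      have h1 := iterate_parent_level (fun v hv => (hpar v hv).2) a v (by omega)
      exact (ih (by omega)).trans (hpar (par^[a] v) (by omega)).1.reachable
  by_contra! hlt
  refine hfree (contains_thetaGraph_of_dense (i₀ := i) hq hq0 hpar i hi le_rfl
    (distLevel G x i) (distLevel G x (i + 1))
    ((distLevel G x i ×ˢ distLevel G x (i + 1)).filter fun e => G.Adj e.1 e.2) x ?_ ?_ ?_ ?_)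
  · intro s hs
    obtain ⟨hr, hd⟩ := mem_distLevel.1 hs
    refine ⟨hd, ?_⟩
    have h1 := iterate_parent_level (fun v hv => (hpar v hv).2) i s (by omega)
    exact ((hreach i s hr hd.ge).dist_eq_zero_iff.1 (by omega)).symm
  · intro w hw
    exact (mem_distLevel.1 hw).2
  · intro e he
    obtain ⟨h1, h2⟩ := Finset.mem_filter.1 he
    exact ⟨(Finset.mem_product.1 h1).1, (Finset.mem_product.1 h1).2, h2⟩
  · rw [Finset.card_filter, Finset.sum_product]
    simp only [← Finset.card_filter]
    refine lt_of_le_of_lt (Nat.mul_le_mul_right _ ?_) hlt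
    exact Nat.mul_le_mul_left _ (Nat.pow_le_pow_right (by omega) hi.le)

open Classical in
/-- In a bipartite graph without theta graphs, distance levels grow proportionally to the
minimum degree. -/
lemma distLevel_growth {V : Type*} [Fintype V] {G : SimpleGraph V} {k p q : ℕ}
    (hq : p * (k + 1) ≤ q) (hq0 : 0 < q) (hfree : ¬ G.Contains (thetaGraph k p))
    (c : G.Coloring Bool) (x : V) (δ : ℕ → ℕ)
    (hδ : ∀ i < k, ∀ v ∈ distLevel G x i, δ i ≤ (Finset.univ.filter (G.Adj v)).card)
    (hδK : ∀ i < k, 6 * (q * (2 * q) ^ k) ≤ δ i) (i : ℕ) (hi : i < k) :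
    (distLevel G x i).card ≤ (distLevel G x (i + 1)).card ∧
      δ i * (distLevel G x i).card ≤ 2 * (q * (2 * q) ^ k) * (distLevel G x (i + 1)).card := by
  set K := q * (2 * q) ^ k with hK
  have hK0 : 0 < K := by positivity
  have hlower : δ i * (distLevel G x i).card ≤
      ∑ v ∈ distLevel G x i, (Finset.univ.filter (G.Adj v)).card := by
    rw [mul_comm]
    exact Finset.card_nsmul_le_sum _ _ _ (hδ i hi)
  have hup := sum_card_adj_distLevel_le hq hq0 hfree x i hi
  rw [← hK] at hup
  have hmain : δ i * (distLevel G x i).card ≤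
      3 * (K * (distLevel G x i).card) + K * (distLevel G x (i + 1)).card := by
    cases i with
    | zero =>
      have h1 : ∑ v ∈ distLevel G x 0, (Finset.univ.filter (G.Adj v)).card ≤
          ∑ v ∈ distLevel G x 0, ((distLevel G x (0 + 1)).filter (G.Adj v)).card := by
        refine Finset.sum_le_sum fun v hv => Finset.card_le_card fun u hu => ?_
        have hadj := (Finset.mem_filter.1 hu).2
        rcases mem_distLevel_of_adj c hv hadj with h | h
        · exact Finset.mem_filter.2 ⟨h, hadj⟩
        · omega
      rw [mul_add] at hup
      omega
    | succ i =>
      have ih := (distLevel_growth hq hq0 hfree c x δ hδ hδK i (by omega)).1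
      have hdown := sum_card_adj_distLevel_le hq hq0 hfree x i (by omega)
      have hswap : ∑ v ∈ distLevel G x (i + 1), ((distLevel G x i).filter (G.Adj v)).card =
          ∑ v ∈ distLevel G x i, ((distLevel G x (i + 1)).filter (G.Adj v)).card := by
        simp only [Finset.card_filter]
        rw [Finset.sum_comm]
        simp only [G.adj_comm]
      have h1 : ∑ v ∈ distLevel G x (i + 1), (Finset.univ.filter (G.Adj v)).card ≤
          ∑ v ∈ distLevel G x (i + 1), ((distLevel G x (i + 1 + 1)).filter (G.Adj v)).card +
          ∑ v ∈ distLevel G x (i + 1), ((distLevel G x i).filter (G.Adj v)).card := by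
        rw [← Finset.sum_add_distrib]
        refine Finset.sum_le_sum fun v hv =>
          (Finset.card_le_card fun u hu => ?_).trans (Finset.card_union_le _ _)
        have hadj := (Finset.mem_filter.1 hu).2
        rcases mem_distLevel_of_adj c hv hadj with h | h
        · exact Finset.mem_union_left _ (Finset.mem_filter.2 ⟨h, hadj⟩)
        · exact Finset.mem_union_right _ (Finset.mem_filter.2 ⟨h.2, hadj⟩)
      rw [← hK] at hdown
      have h2 := Nat.mul_le_mul_left K ih
      rw [mul_add] at hup hdown
      omega
  have h6 := Nat.mul_le_mul_right (distLevel G x i).card (hδK i hi)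
  rw [mul_assoc] at h6
  have h3 : 3 * (K * (distLevel G x i).card) ≤ K * (distLevel G x (i + 1)).card := by omega
  refine ⟨?_, ?_⟩
  · have h4 : K * (distLevel G x i).card ≤ K * (distLevel G x (i + 1)).card := by omega
    exact Nat.le_of_mul_le_mul_left h4 hK0
  · rw [mul_assoc]
    omega

open Classical in
lemma prod_le_card_distLevel {V : Type*} [Fintype V] {G : SimpleGraph V} {k p q : ℕ}
    (hq : p * (k + 1) ≤ q) (hq0 : 0 < q) (hfree : ¬ G.Contains (thetaGraph k p))
    (c : G.Coloring Bool) (x : V) (δ : ℕ → ℕ)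
    (hδ : ∀ i < k, ∀ v ∈ distLevel G x i, δ i ≤ (Finset.univ.filter (G.Adj v)).card)
    (hδK : ∀ i < k, 6 * (q * (2 * q) ^ k) ≤ δ i) (i : ℕ) (hi : i ≤ k) :
    ∏ j ∈ Finset.range i, δ j ≤ (2 * (q * (2 * q) ^ k)) ^ i * (distLevel G x i).card := by
  induction i with
  | zero =>
    have : x ∈ distLevel G x 0 := mem_distLevel.2 ⟨Reachable.refl x, dist_self⟩
    simpa using Finset.card_pos.2 ⟨x, this⟩
  | succ i ih =>
    have h := (distLevel_growth hq hq0 hfree c x δ hδ hδK i (by omega)).2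
    rw [Finset.prod_range_succ, pow_succ]
    calc _ ≤ (2 * (q * (2 * q) ^ k)) ^ i * (distLevel G x i).card * δ i :=
          Nat.mul_le_mul_right _ (ih (by omega))
      _ = (2 * (q * (2 * q) ^ k)) ^ i * (δ i * (distLevel G x i).card) := by ring
      _ ≤ (2 * (q * (2 * q) ^ k)) ^ i *
          (2 * (q * (2 * q) ^ k) * (distLevel G x (i + 1)).card) := Nat.mul_le_mul_left _ h
      _ = _ := by ring

open Classical in
/-- In a nonempty bipartite graph without theta graphs whose non-isolated vertices of colour `b`
have degree at least `D b`, the colour classes are large. -/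
lemma prod_degree_le_card_color {V : Type*} [Fintype V] {G : SimpleGraph V} {k p q : ℕ}
    (hq : p * (k + 1) ≤ q) (hq0 : 0 < q) (hfree : ¬ G.Contains (thetaGraph k p))
    (c : G.Coloring Bool) (D : Bool → ℕ)
    (hD : ∀ v u, G.Adj v u → D (c v) ≤ (Finset.univ.filter (G.Adj v)).card)
    (hDK : ∀ b, 6 * (q * (2 * q) ^ k) ≤ D b) {x y : V} (hxy : G.Adj x y) :
    ∏ j ∈ Finset.range k, D (if Even j then c x else !c x) ≤
      (2 * (q * (2 * q) ^ k)) ^ k *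
        (Finset.univ.filter fun v => c v = if Even k then c x else !c x).card := by
  have hcol : ∀ i, ∀ v ∈ distLevel G x i, c v = if Even i then c x else !c x := by
    intro i v hv
    have := coloring_of_mem_distLevel c hv
    split_ifs with h
    · exact (this.1 h).symm
    · exact Bool.eq_not.2 fun h' => h (this.2 h'.symm)
  have hmain := prod_le_card_distLevel hq hq0 hfree c x
    (fun j => D (if Even j then c x else !c x)) (fun i _ v hv => by
      simp only [← hcol i v hv]
      rcases Nat.eq_zero_or_pos (G.dist x v) with h0 | hpos
      · obtain rfl := (mem_distLevel.1 hv).1.dist_eq_zero_iff.1 h0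
        exact hD _ _ hxy
      · obtain ⟨u, hu, -⟩ := exists_adj_dist_add_one hpos
        exact hD _ _ hu) (fun i _ => hDK _) k le_rfl
  refine hmain.trans (Nat.mul_le_mul_left _ (Finset.card_le_card fun v hv => ?_))
  exact Finset.mem_filter.2 ⟨Finset.mem_univ _, hcol k v hv⟩

open Classical in
/-- A dense bipartite graph without theta graphs has parts that are large compared with its
average degrees. -/
lemma exists_degrees_prod_le {m n k p q : ℕ} (hm : 0 < m) (hn : 0 < n)
    (hq : p * (k + 1) ≤ q) (hq0 : 0 < q) {G : SimpleGraph (Fin m ⊕ Fin n)}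
    (hfree : ¬ G.Contains (thetaGraph k p)) {E : Finset (Fin m × Fin n)}
    (hE : ∀ e ∈ E, G.Adj (Sum.inl e.1) (Sum.inr e.2))
    (hEm : 24 * (q * (2 * q) ^ k) * m ≤ E.card) (hEn : 24 * (q * (2 * q) ^ k) * n ≤ E.card) :
    ∃ a b : ℕ, E.card ≤ 4 * m * a ∧ E.card ≤ 4 * n * b ∧
      ∏ j ∈ Finset.range k, (if Even j then a else b) ≤
        (2 * (q * (2 * q) ^ k)) ^ k * (if Even k then m else n) ∧
      ∏ j ∈ Finset.range k, (if Even j then b else a) ≤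
        (2 * (q * (2 * q) ^ k)) ^ k * (if Even k then n else m) := by
  set K := q * (2 * q) ^ k with hK
  have hK0 : 0 < K := by positivity
  have hE0 : 0 < E.card := lt_of_lt_of_le (by positivity) hEm
  obtain ⟨E', hE', ⟨e₀, he₀⟩, hd1, hd2⟩ := exists_subset_degree_lt
    (fun _ : Fin m => E.card / (4 * m)) (fun _ : Fin n => E.card / (4 * n)) E
    Finset.univ Finset.univ (fun _ _ => ⟨Finset.mem_univ _, Finset.mem_univ _⟩) (by
      simp only [Finset.sum_const, Finset.card_univ, Fintype.card_fin, smul_eq_mul]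
      have h1 := Nat.mul_div_le E.card (4 * m)
      have h2 := Nat.mul_div_le E.card (4 * n)
      rw [mul_assoc] at h1 h2
      omega)
  let H : SimpleGraph (Fin m ⊕ Fin n) :=
    { Adj := fun u v => ∃ e ∈ E', (u = Sum.inl e.1 ∧ v = Sum.inr e.2) ∨
        (v = Sum.inl e.1 ∧ u = Sum.inr e.2)
      symm := ⟨fun u v ⟨e, he, h⟩ => ⟨e, he, h.symm⟩⟩
      loopless := ⟨by
        rintro u ⟨e, -, ⟨h1, h2⟩ | ⟨h1, h2⟩⟩ <;> rw [h1] at h2 <;> simp at h2⟩ }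
  have hHG : H ≤ G := by
    rintro u v ⟨e, he, ⟨rfl, rfl⟩ | ⟨rfl, rfl⟩⟩
    · exact hE e (hE' he)
    · exact (hE e (hE' he)).symm
  have hHfree : ¬ H.Contains (thetaGraph k p) := fun ⟨f, hf⟩ =>
    hfree ⟨⟨f, fun h => hHG (f.map_rel h)⟩, hf⟩
  let c : H.Coloring Bool := Coloring.mk Sum.isLeft (by
    rintro u v ⟨e, he, ⟨rfl, rfl⟩ | ⟨rfl, rfl⟩⟩ <;> simp)
  let D : Bool → ℕ := fun b => if b then E.card / (4 * m) + 1 else E.card / (4 * n) + 1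
  have hD : ∀ v u, H.Adj v u → D (c v) ≤ (Finset.univ.filter (H.Adj v)).card := by
    rintro v u ⟨e, he, ⟨rfl, rfl⟩ | ⟨rfl, rfl⟩⟩
    · refine le_trans (Nat.succ_le_of_lt (hd1 e he)) (Finset.card_le_card_of_injOn
        (fun e' => Sum.inr e'.2) (fun e' h' => ?_) (fun a ha b hb hab => ?_))
      · obtain ⟨h1, h2⟩ := Finset.mem_filter.1 h'
        exact Finset.mem_filter.2 ⟨Finset.mem_univ _, e', h1, Or.inl ⟨by rw [h2], rfl⟩⟩
      · exact Prod.ext ((Finset.mem_filter.1 ha).2.trans (Finset.mem_filter.1 hb).2.symm)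
          (Sum.inr_injective hab)
    · refine le_trans (Nat.succ_le_of_lt (hd2 e he)) (Finset.card_le_card_of_injOn
        (fun e' => Sum.inl e'.1) (fun e' h' => ?_) (fun a ha b hb hab => ?_))
      · obtain ⟨h1, h2⟩ := Finset.mem_filter.1 h'
        exact Finset.mem_filter.2 ⟨Finset.mem_univ _, e', h1, Or.inr ⟨rfl, by rw [h2]⟩⟩
      · exact Prod.ext (Sum.inl_injective hab)
          ((Finset.mem_filter.1 ha).2.trans (Finset.mem_filter.1 hb).2.symm)
  have hDK : ∀ b, 6 * K ≤ D b := by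
    have h1 : 6 * K ≤ E.card / (4 * m) := by
      rw [Nat.le_div_iff_mul_le (by omega)]
      exact le_trans (by ring_nf; rfl) hEm
    have h2 : 6 * K ≤ E.card / (4 * n) := by
      rw [Nat.le_div_iff_mul_le (by omega)]
      exact le_trans (by ring_nf; rfl) hEn
    rintro (_ | _) <;> simp [D] <;> omega
  have hleft : (Finset.univ.filter fun v => c v = true).card = m := by
    have : (Finset.univ.filter fun v => c v = true) =
        (Finset.univ : Finset (Fin m)).map ⟨Sum.inl, Sum.inl_injective⟩ := by
      ext (v | v) <;> simp [c, Coloring.mk]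
    rw [this]; simp
  have hright : (Finset.univ.filter fun v => c v = false).card = n := by
    have : (Finset.univ.filter fun v => c v = false) =
        (Finset.univ : Finset (Fin n)).map ⟨Sum.inr, Sum.inr_injective⟩ := by
      ext (v | v) <;> simp [c, Coloring.mk]
    rw [this]; simp
  have hadj : H.Adj (Sum.inl e₀.1) (Sum.inr e₀.2) := ⟨e₀, he₀, Or.inl ⟨rfl, rfl⟩⟩
  have hA := prod_degree_le_card_color hq hq0 hHfree c D
    (fun v u h => by convert hD v u h) hDK hadj
  have hB := prod_degree_le_card_color hq hq0 hHfree c D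
    (fun v u h => by convert hD v u h) hDK hadj.symm
  have hcl : c (Sum.inl e₀.1) = true := rfl
  have hcr : c (Sum.inr e₀.2) = false := rfl
  refine ⟨E.card / (4 * m) + 1, E.card / (4 * n) + 1, ?_, ?_, ?_, ?_⟩
  · exact (Nat.lt_mul_div_succ _ (by omega)).le
  · exact (Nat.lt_mul_div_succ _ (by omega)).le
  · convert hA using 2
    · simp only [hcl, D]
      split_ifs <;> simp_all
    · rw [hcl]
      split_ifs <;> simp_all
  · convert hB using 2
    · simp only [hcr, D]
      split_ifs <;> simp_all
    · rw [hcr]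
      split_ifs <;> simp_all

lemma prod_range_two_mul_ite_even (a b t : ℕ) :
    ∏ j ∈ Finset.range (2 * t), (if Even j then a else b) = (a * b) ^ t := by
  induction t with
  | zero => simp
  | succ t ih =>
    rw [show 2 * (t + 1) = 2 * t + 1 + 1 by ring, Finset.prod_range_succ, Finset.prod_range_succ,
      ih, if_pos (even_two_mul t), if_neg (by simp), pow_succ, mul_assoc]

lemma even_edge_bound {m n a b e t L : ℕ} (ht : 0 < t) (ha : e ≤ 4 * m * a) (hb : e ≤ 4 * n * b)
    (h : (a * b) ^ t ≤ L ^ (2 * t) * m) :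
    (e : ℝ) ≤ 4 * L * ((m : ℝ) ^ ((((2 * t : ℕ) : ℝ) + 2) / (2 * (2 * t : ℕ))) *
      (n : ℝ) ^ ((1 : ℝ) / 2)) := by
  have hpow : e ^ (2 * t) ≤ (4 * L) ^ (2 * t) * (m ^ (t + 1) * n ^ t) := by
    calc e ^ (2 * t) = (e * e) ^ t := by rw [pow_mul, sq]
      _ ≤ (4 * m * a * (4 * n * b)) ^ t := by gcongr
      _ = (16 * m * n) ^ t * (a * b) ^ t := by rw [← mul_pow]; ring
      _ ≤ (16 * m * n) ^ t * (L ^ (2 * t) * m) := by gcongr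
      _ = _ := by
        rw [mul_pow 4 L, pow_mul 4 2 t]; norm_num; ring
  have ht' : (0 : ℝ) < t := by exact_mod_cast ht
  refine le_of_pow_le_pow_left₀ (n := 2 * t) (by omega) (by positivity) ?_
  rw [mul_pow, mul_pow ((m : ℝ) ^ _), ← Real.rpow_mul_natCast (by positivity),
    ← Real.rpow_mul_natCast (by positivity),
    show (((2 * t : ℕ) : ℝ) + 2) / (2 * (2 * t : ℕ)) * (2 * t : ℕ) = (t + 1 : ℕ) by
      push_cast; field_simp,
    show (1 : ℝ) / 2 * (2 * t : ℕ) = (t : ℕ) by push_cast; field_simp,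
    Real.rpow_natCast, Real.rpow_natCast]
  exact_mod_cast hpow

lemma odd_edge_bound {m n a b e t L : ℕ} (ha : e ≤ 4 * m * a) (hb : e ≤ 4 * n * b)
    (h1 : (a * b) ^ t * a ≤ L ^ (2 * t + 1) * n) (h2 : (b * a) ^ t * b ≤ L ^ (2 * t + 1) * m) :
    (e : ℝ) ≤ 4 * L *
      ((m : ℝ) * n) ^ ((((2 * t + 1 : ℕ) : ℝ) + 1) / (2 * (2 * t + 1 : ℕ))) := by
  have hpow : e ^ (2 * (2 * t + 1)) ≤ (4 * L) ^ (2 * (2 * t + 1)) * (m * n) ^ (2 * t + 2) := by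
    calc e ^ (2 * (2 * t + 1)) = (e * e) ^ (2 * t + 1) := by rw [pow_mul, sq]
      _ ≤ (4 * m * a * (4 * n * b)) ^ (2 * t + 1) := by gcongr
      _ = (16 * m * n) ^ (2 * t + 1) * (((a * b) ^ t * a) * ((b * a) ^ t * b)) := by
        rw [mul_comm b a, show (a * b) ^ t * a * ((a * b) ^ t * b) = (a * b) ^ (2 * t + 1) by ring,
          ← mul_pow]
        ring
      _ ≤ (16 * m * n) ^ (2 * t + 1) * ((L ^ (2 * t + 1) * n) * (L ^ (2 * t + 1) * m)) := by
        gcongr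
      _ = _ := by
        rw [mul_pow 4 L, pow_mul 4 2]; norm_num; ring
  refine le_of_pow_le_pow_left₀ (n := 2 * (2 * t + 1)) (by omega) (by positivity) ?_
  rw [mul_pow, ← Real.rpow_mul_natCast (by positivity),
    show (((2 * t + 1 : ℕ) : ℝ) + 1) / (2 * (2 * t + 1 : ℕ)) * (2 * (2 * t + 1) : ℕ) =
      (2 * t + 2 : ℕ) by push_cast; field_simp; ring,
    Real.rpow_natCast]
  exact_mod_cast hpow

open Classical in
lemma ncard_edgeSet_le_card_filter {m n : ℕ} {G : SimpleGraph (Fin m ⊕ Fin n)}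
    (hG : G ≤ completeBipartiteGraph (Fin m) (Fin n)) :
    G.edgeSet.ncard ≤
      (Finset.univ.filter fun e : Fin m × Fin n => G.Adj (Sum.inl e.1) (Sum.inr e.2)).card := by
  have hsub : G.edgeSet ⊆ (fun e : Fin m × Fin n => s(Sum.inl e.1, Sum.inr e.2)) ''
      (Finset.univ.filter fun e : Fin m × Fin n => G.Adj (Sum.inl e.1) (Sum.inr e.2)) := by
    intro s
    induction s with
    | _ u v =>
      intro h
      rw [mem_edgeSet] at h
      have hb := hG h
      rcases u with u | u <;> rcases v with v | v
      · simp at hb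
      · exact ⟨(u, v), by simpa using h, rfl⟩
      · exact ⟨(v, u), by simpa using h.symm, Sym2.eq_swap⟩
      · simp at hb
  refine (Set.ncard_le_ncard hsub (Set.toFinite _)).trans ?_
  exact (Set.ncard_image_le (Set.toFinite _)).trans (Set.ncard_coe_finset _).le

lemma zNum_le_of_forall {β : Type*} {m n : ℕ} {H : SimpleGraph β} {B : ℝ} (hB : 0 ≤ B)
    (h : ∀ G : SimpleGraph (Fin m ⊕ Fin n), G ≤ completeBipartiteGraph (Fin m) (Fin n) →
      ¬ G.Contains H → (G.edgeSet.ncard : ℝ) ≤ B) : (zNum m n H : ℝ) ≤ B := by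
  refine le_trans (Nat.cast_le.2 (csSup_le' ?_)) (Nat.floor_le hB)
  rintro N ⟨G, hG, hfree, rfl⟩
  exact Nat.le_floor (h G hG hfree)

/-- For all $k, p ≥ 2$ there is $c = c(k,p) > 0$ such that for all $2 ≤ m ≤ n$:
if $k$ is odd then $z(m,n,θ_{k,p}) ≤ c((mn)^{(k+1)/(2k)} + m + n)$, and if $k$ is even
then $z(m,n,θ_{k,p}) ≤ c(m^{(k+2)/(2k)} n^{1/2} + m + n)$. -/
theorem z_theta_upper (k p : ℕ) (hk : 2 ≤ k) (hp : 2 ≤ p) :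
    ∃ c : ℝ, 0 < c ∧ ∀ m n : ℕ, 2 ≤ m → m ≤ n →
      (Odd k → (zNum m n (thetaGraph k p) : ℝ) ≤
        c * (((m : ℝ) * n) ^ (((k : ℝ) + 1) / (2 * k)) + m + n)) ∧
      (Even k → (zNum m n (thetaGraph k p) : ℝ) ≤
        c * ((m : ℝ) ^ (((k : ℝ) + 2) / (2 * k)) * (n : ℝ) ^ ((1 : ℝ) / 2) + m + n)) := by
  classical
  set q := p * (k + 1) with hq
  have hq0 : 0 < q := by positivity
  set K := q * (2 * q) ^ k with hK
  have hK0 : 0 < K := by positivity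
  have hKR : (0 : ℝ) < K := by exact_mod_cast hK0
  refine ⟨24 * K, by positivity, fun m n hm hmn => ?_⟩
  have key : ∀ X : ℝ, 0 ≤ X →
      (∀ e a b : ℕ, e ≤ 4 * m * a → e ≤ 4 * n * b →
        ∏ j ∈ Finset.range k, (if Even j then a else b) ≤
          (2 * K) ^ k * (if Even k then m else n) →
        ∏ j ∈ Finset.range k, (if Even j then b else a) ≤
          (2 * K) ^ k * (if Even k then n else m) → (e : ℝ) ≤ 4 * (2 * K : ℕ) * X) →
      (zNum m n (thetaGraph k p) : ℝ) ≤ 24 * K * (X + m + n) := by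
    intro X hX hbound
    refine zNum_le_of_forall (by positivity) fun G hG hfree => ?_
    refine le_trans (Nat.cast_le.2 (ncard_edgeSet_le_card_filter hG)) ?_
    set E := Finset.univ.filter fun e : Fin m × Fin n => G.Adj (Sum.inl e.1) (Sum.inr e.2)
    have hX' : 0 ≤ K * X := by positivity
    have hm' : (0 : ℝ) ≤ K * m := by positivity
    have hn' : (0 : ℝ) ≤ K * n := by positivity
    by_cases hlarge : 24 * K * m ≤ E.card ∧ 24 * K * n ≤ E.card
    · obtain ⟨a, b, ha, hb, h1, h2⟩ := exists_degrees_prod_le (by omega) (by omega) hq.ge hq0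
        hfree (fun e he => (Finset.mem_filter.1 he).2) hlarge.1 hlarge.2
      have := hbound _ a b ha hb h1 h2
      push_cast at this
      linarith
    · have hle : E.card ≤ 24 * K * m + 24 * K * n := by omega
      have : (E.card : ℝ) ≤ 24 * K * m + 24 * K * n := by exact_mod_cast hle
      linarith
  constructor
  · rintro ⟨t, ht⟩
    refine key _ (by positivity) fun e a b ha hb h1 h2 => ?_
    have hodd : ¬ Even k := by rw [ht]; simp
    rw [if_neg hodd, ht, Finset.prod_range_succ, prod_range_two_mul_ite_even,
      if_pos (even_two_mul t)] at h1 h2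
    rw [show (k : ℝ) = ((2 * t + 1 : ℕ) : ℝ) by rw [ht]]
    exact odd_edge_bound ha hb h1 h2
  · intro hev
    obtain ⟨t, ht⟩ := even_iff_exists_two_mul.1 hev
    refine key _ (by positivity) fun e a b ha hb h1 _ => ?_
    rw [if_pos hev, ht, prod_range_two_mul_ite_even] at h1
    rw [show (k : ℝ) = ((2 * t : ℕ) : ℝ) by rw [ht]]
    exact even_edge_bound (by omega) ha hb h1
end
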